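/- For every pair of integers m and n with m ≥ 93 and n ≥ 31m, one has μ(n, n−m) = 2n − ⌊n/m⌋; that is, the smallest integer N for which there exist a digraph D on n vertices with exactly n−m arcs and a digraph D' on n vertices with exactly N arcs that do not pack equals 2n − ⌊n/m⌋. -/

import Mathlib

/-- A digraph on `Fin n` given by its finite arc set: arcs are ordered pairs
of distinct vertices (irreflexivity). -/
def IsDigraph {n : ℕ} (A : Finset (Fin n × Fin n)) : Prop :=
  ∀ p ∈ A, p.1 ≠ p.2

/-- Two digraphs on `n` vertices pack if there is a bijection of the vertex
sets sending every arc of the first to a non-arc of the second. -/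
def Packs {n : ℕ} (A A' : Finset (Fin n × Fin n)) : Prop :=
  ∃ f : Fin n ≃ Fin n, ∀ p ∈ A, (f p.1, f p.2) ∉ A'

section partc1
open Finset
set_option linter.unusedSectionVars false

section core
variable {α : Type*} [Fintype α] [DecidableEq α]

def outN (A : Finset (α × α)) (x : α) : Finset α := univ.filter (fun y => (x, y) ∈ A)
def inN (A : Finset (α × α)) (x : α) : Finset α := univ.filter (fun y => (y, x) ∈ A)
def deg (A : Finset (α × α)) (x : α) : ℕ := (outN A x).card + (inN A x).card

theorem mem_outN {A : Finset (α × α)} {x y : α} : y ∈ outN A x ↔ (x, y) ∈ A := by simp [outN]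
theorem mem_inN {A : Finset (α × α)} {x y : α} : y ∈ inN A x ↔ (y, x) ∈ A := by simp [inN]

theorem sum_outN (A : Finset (α × α)) : ∑ x, (outN A x).card = A.card := by
  rw [Finset.card_eq_sum_card_fiberwise (f := Prod.fst) (t := univ) (by simp)]
  refine Finset.sum_congr rfl fun x _ => ?_
  refine Finset.card_bij (fun y _ => (x, y)) ?_ ?_ ?_
  · intro y hy; simpa [outN] using hy
  · intro y _ z _ h; simpa using h
  · rintro ⟨a, b⟩ h
    simp only [mem_filter] at h
    obtain ⟨h, rfl⟩ := h
    exact ⟨b, by simpa [outN] using h, rfl⟩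

theorem sum_inN (A : Finset (α × α)) : ∑ x, (inN A x).card = A.card := by
  rw [Finset.card_eq_sum_card_fiberwise (f := Prod.snd) (t := univ) (by simp)]
  refine Finset.sum_congr rfl fun x _ => ?_
  refine Finset.card_bij (fun y _ => (y, x)) ?_ ?_ ?_
  · intro y hy; simpa [inN] using hy
  · intro y _ z _ h; simpa using h
  · rintro ⟨a, b⟩ h
    simp only [mem_filter] at h
    obtain ⟨h, rfl⟩ := h
    exact ⟨a, by simpa [inN] using h, rfl⟩

theorem sum_deg (A : Finset (α × α)) : ∑ x, deg A x = 2 * A.card := by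
  simp only [deg, Finset.sum_add_distrib, sum_outN, sum_inN]; ring

/-- counting step -/
theorem count_step (P : Finset (Equiv.Perm α)) (F : Finset α) (t w : α) (hw : w ∉ F)
    (hF : ∀ σ ∈ P, σ t ∉ F)
    (hs : ∀ σ ∈ P, ∀ u v, u ∉ F → v ∉ F → Equiv.swap u v * σ ∈ P) :
    (P.filter (fun σ => σ t = w)).card * (Fintype.card α - F.card) = P.card := by
  rw [Finset.card_eq_sum_card_fiberwise (f := fun σ : Equiv.Perm α => σ t) (s := P) (t := Fᶜ)
    (by intro σ hσ; simpa using hF σ hσ)]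
  rw [Finset.sum_congr rfl (g := fun _ => (P.filter (fun σ => σ t = w)).card), Finset.sum_const,
    Finset.card_compl, smul_eq_mul, mul_comm]
  intro v hv
  simp only [mem_compl] at hv
  refine Finset.card_bij (fun σ _ => Equiv.swap v w * σ) ?_ ?_ ?_
  · intro σ hσ
    simp only [mem_filter] at hσ ⊢
    refine ⟨hs _ hσ.1 _ _ hv hw, ?_⟩
    simp [hσ.2]
  · intro a _ b _ h; exact mul_left_cancel h
  · intro σ hσ
    simp only [mem_filter] at hσ
    refine ⟨Equiv.swap v w * σ, ?_, ?_⟩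
    · simp only [mem_filter]
      exact ⟨hs _ hσ.1 _ _ hv hw, by simp [hσ.2]⟩
    · rw [← mul_assoc, Equiv.swap_mul_self, one_mul]

def P2 (x y u v : α) : Finset (Equiv.Perm α) := univ.filter (fun σ => σ x = u ∧ σ y = v)

theorem count2 {x y u v : α} (hxy : x ≠ y) (huv : u ≠ v) :
    (P2 x y u v).card * ((Fintype.card α - 1) * Fintype.card α) = (Fintype.card α).factorial := by
  have h1 := count_step (univ : Finset (Equiv.Perm α)) ∅ x u (by simp) (by simp) (by simp)
  have h2 := count_step (univ.filter (fun σ : Equiv.Perm α => σ x = u)) {u} y v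
    (by simpa using huv.symm)
    (by
      intro σ hσ h
      simp only [mem_filter, mem_univ, true_and, mem_singleton] at hσ h
      exact hxy (σ.injective (hσ.trans h.symm)))
    (by
      intro σ hσ a b ha hb
      simp only [mem_filter, mem_univ, true_and, mem_singleton] at *
      simp [hσ, Equiv.swap_apply_of_ne_of_ne (Ne.symm ha) (Ne.symm hb)])
  rw [Finset.filter_filter] at h2
  simp only [card_empty, Nat.sub_zero, card_univ, card_singleton] at h1 h2
  rw [Fintype.card_perm] at h1
  rw [← h1, ← h2, mul_assoc]; rfl

theorem count3 {x y t u v w : α} (hxt : x ≠ t) (hyt : y ≠ t) (huv : u ≠ v)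
    (huw : w ≠ u) (hvw : w ≠ v) :
    ((P2 x y u v).filter (fun σ => σ t = w)).card * (Fintype.card α - 2) = (P2 x y u v).card := by
  have := count_step (P2 x y u v) {u, v} t w (by simp [huw, hvw])
    (by
      intro σ hσ h
      simp only [P2, mem_filter, mem_univ, true_and, mem_singleton, mem_insert] at hσ h
      rcases h with h | h
      · exact hxt (σ.injective (hσ.1.trans h.symm))
      · exact hyt (σ.injective (hσ.2.trans h.symm)))
    (by
      intro σ hσ a b ha hb
      simp only [P2, mem_filter, mem_univ, true_and, mem_singleton, mem_insert, not_or] at *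
      simp [hσ, Equiv.swap_apply_of_ne_of_ne (Ne.symm ha.1) (Ne.symm hb.1),
        Equiv.swap_apply_of_ne_of_ne (Ne.symm ha.2) (Ne.symm hb.2)])
  rwa [Finset.card_pair huv] at this
end core

end partc1

section partc2
open Finset
set_option linter.unusedSectionVars false

section core
variable {α : Type*} [Fintype α] [DecidableEq α]

def hf (A B : Finset (α × α)) (x r u w : α) : ℕ :=
  (if (x, r) ∈ A then (inN B w).card else 0) + (if (r, x) ∈ A then (outN B w).card else 0) +
  (if (u, w) ∈ B then (inN A r).card else 0) + (if (w, u) ∈ B then (outN A r).card else 0)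

theorem sum_hf (A B : Finset (α × α)) (x u : α) :
    ∑ r, ∑ w, hf A B x r u w = deg A x * B.card + deg B u * A.card := by
  have e1 : ∀ (C : Finset (α × α)) (z : α) (k : ℕ),
      ∑ r, (if (z, r) ∈ C then k else 0) = (outN C z).card * k := by
    intro C z k; rw [← Finset.sum_filter, Finset.sum_const, smul_eq_mul]; rfl
  have e2 : ∀ (C : Finset (α × α)) (z : α) (k : ℕ),
      ∑ r, (if (r, z) ∈ C then k else 0) = (inN C z).card * k := by
    intro C z k; rw [← Finset.sum_filter, Finset.sum_const, smul_eq_mul]; rfl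
  have f1 : ∑ r, ∑ w, (if (x, r) ∈ A then (inN B w).card else 0) = (outN A x).card * B.card := by
    rw [Finset.sum_comm]; simp only [e1]; rw [← Finset.mul_sum, sum_inN]
  have f2 : ∑ r, ∑ w, (if (r, x) ∈ A then (outN B w).card else 0) = (inN A x).card * B.card := by
    rw [Finset.sum_comm]; simp only [e2]; rw [← Finset.mul_sum, sum_outN]
  have f3 : ∑ r, ∑ w, (if (u, w) ∈ B then (inN A r).card else 0) = (outN B u).card * A.card := by
    simp only [e1]; rw [← Finset.mul_sum, sum_inN]
  have f4 : ∑ r, ∑ w, (if (w, u) ∈ B then (outN A r).card else 0) = (inN B u).card * A.card := by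
    simp only [e2]; rw [← Finset.mul_sum, sum_outN]
  simp only [hf, Finset.sum_add_distrib, f1, f2, f3, f4, deg]
  ring

def SS (A B : Finset (α × α)) (σ : Equiv.Perm α) (x y : α) : ℕ :=
  ∑ r ∈ univ \ {x, y}, hf A B x r (σ x) (σ r)

theorem avg3 (A B : Finset (α × α)) {x y u v : α} (huv : u ≠ v) :
    (Fintype.card α - 2) * ∑ σ ∈ P2 x y u v, SS A B σ x y
      ≤ (P2 x y u v).card * (deg A x * B.card + deg B u * A.card) := by
  have h0 : ∑ σ ∈ P2 x y u v, SS A B σ x y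
      = ∑ r ∈ univ \ {x, y}, ∑ w, ((P2 x y u v).filter (fun σ => σ r = w)).card * hf A B x r u w := by
    unfold SS
    rw [Finset.sum_comm]
    refine Finset.sum_congr rfl fun r _ => ?_
    rw [← Finset.sum_fiberwise (P2 x y u v) (fun σ => σ r)]
    refine Finset.sum_congr rfl fun w _ => ?_
    rw [Finset.card_eq_sum_ones, Finset.sum_mul]
    refine Finset.sum_congr rfl fun σ hσ => ?_
    simp only [P2, mem_filter, mem_univ, true_and] at hσ
    rw [hσ.1.1, hσ.2, one_mul]
  rw [h0, ← sum_hf, Finset.mul_sum, Finset.mul_sum]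
  refine (Finset.sum_le_sum (g := fun r => (P2 x y u v).card * ∑ w, hf A B x r u w) ?_).trans
    (Finset.sum_le_sum_of_subset (Finset.subset_univ _))
  intro r hr
  simp only [mem_sdiff, mem_univ, true_and, mem_insert, mem_singleton, not_or] at hr
  rw [Finset.mul_sum, Finset.mul_sum]
  refine Finset.sum_le_sum fun w _ => ?_
  rw [← mul_assoc]
  refine Nat.mul_le_mul_right _ ?_
  by_cases hw : w = u ∨ w = v
  · have : (P2 x y u v).filter (fun σ => σ r = w) = ∅ := by
      apply Finset.filter_eq_empty_iff.2
      intro σ hσ h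
      simp only [P2, mem_filter, mem_univ, true_and] at hσ
      rcases hw with rfl | rfl
      · exact hr.1 (σ.injective (h.trans hσ.1.symm))
      · exact hr.2 (σ.injective (h.trans hσ.2.symm))
    simp [this]
  · push Not at hw
    rw [mul_comm, count3 (Ne.symm hr.1) (Ne.symm hr.2) huv hw.1 hw.2]

def conf (A B : Finset (α × α)) (σ : Equiv.Perm α) : Finset (α × α) :=
  A.filter (fun p => (σ p.1, σ p.2) ∈ B)

def xp (fl : α × α → Bool) (p : α × α) : α := if fl p then p.1 else p.2
def yp (fl : α × α → Bool) (p : α × α) : α := if fl p then p.2 else p.1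

theorem pick_perm (A B : Finset (α × α)) (hA : ∀ p ∈ A, p.1 ≠ p.2) (hB : ∀ p ∈ B, p.1 ≠ p.2)
    (fl : α × α → Bool) (Δ Dm K T0 : ℕ) (hΔ : ∀ x, deg B x ≤ Δ)
    (hDm : ∑ p ∈ A, deg A (xp fl p) ≤ Dm)
    (hN : 3 ≤ Fintype.card α)
    (hmain : (Fintype.card α - 2) * A.card * B.card * T0 + (K + 1) *
        ((Fintype.card α - 2) * B.card * Dm + B.card ^ 2 * Dm + A.card ^ 2 * B.card * Δ)
        < (K + 1) * T0 * ((Fintype.card α - 1) * Fintype.card α) * (Fintype.card α - 2)) :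
    ∃ σ : Equiv.Perm α, (conf A B σ).card ≤ K ∧
      ∑ p ∈ conf A B σ, (deg A (xp fl p) + SS A B σ (xp fl p) (yp fl p)) < T0 := by
  set N := Fintype.card α with hNdef
  obtain ⟨c2, hc2⟩ : ∃ c2 : ℕ, c2 * ((N - 1) * N) = N.factorial := by
    have : 1 < Fintype.card α := by omega
    obtain ⟨x, y, hxy⟩ := Fintype.one_lt_card_iff.1 this
    exact ⟨_, count2 hxy hxy⟩
  have hpos : 0 < (N - 1) * N := by apply Nat.mul_pos <;> omega
  have hP2 : ∀ x y u v : α, x ≠ y → u ≠ v → (P2 x y u v).card = c2 := by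
    intro x y u v h1 h2
    exact Nat.eq_of_mul_eq_mul_right hpos ((count2 h1 h2).trans hc2.symm)
  set W : Equiv.Perm α → ℕ := fun σ => ∑ p ∈ conf A B σ,
    (T0 + (K + 1) * (deg A (xp fl p) + SS A B σ (xp fl p) (yp fl p))) with hW
  by_cases hex : ∃ σ, W σ < (K + 1) * T0
  · obtain ⟨σ, hσ⟩ := hex
    refine ⟨σ, ?_, ?_⟩
    · by_contra hc
      push Not at hc
      have : (K + 1) * T0 ≤ W σ := by
        calc (K + 1) * T0 ≤ (conf A B σ).card * T0 := Nat.mul_le_mul_right _ hc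
          _ = ∑ p ∈ conf A B σ, T0 := by simp
          _ ≤ W σ := Finset.sum_le_sum fun p _ => Nat.le_add_right _ _
      omega
    · have h1 : (K + 1) * ∑ p ∈ conf A B σ, (deg A (xp fl p) + SS A B σ (xp fl p) (yp fl p))
          ≤ W σ := by
        rw [Finset.mul_sum]
        exact Finset.sum_le_sum fun p _ => Nat.le_add_left _ _
      exact Nat.lt_of_mul_lt_mul_left (h1.trans_lt hσ)
  · exfalso
    push Not at hex
    have lower : N.factorial * ((K + 1) * T0) ≤ ∑ σ, W σ := by
      have : ∑ σ : Equiv.Perm α, ((K + 1) * T0) ≤ ∑ σ, W σ := Finset.sum_le_sum fun σ _ => hex σ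
      simpa [Fintype.card_perm] using this
    have hper : ∀ p ∈ A, ∀ q ∈ B,
        (N - 2) * ∑ σ ∈ P2 p.1 p.2 q.1 q.2,
          (T0 + (K + 1) * (deg A (xp fl p) + SS A B σ (xp fl p) (yp fl p)))
        ≤ c2 * ((N - 2) * (T0 + (K + 1) * deg A (xp fl p))
            + (K + 1) * (deg A (xp fl p) * B.card + Δ * A.card)) := by
      intro p hp q hq
      have hcard := hP2 _ _ _ _ (hA p hp) (hB q hq)
      have key : (N - 2) * ∑ σ ∈ P2 p.1 p.2 q.1 q.2, SS A B σ (xp fl p) (yp fl p)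
          ≤ c2 * (deg A (xp fl p) * B.card + Δ * A.card) := by
        cases hf : fl p
        · have h := avg3 A B (x := p.2) (y := p.1) (hB q hq).symm
          have e : P2 p.2 p.1 q.2 q.1 = P2 p.1 p.2 q.1 q.2 := by
            ext σ; simp [P2, and_comm]
          rw [e, hcard] at h
          simp only [xp, yp, hf, Bool.false_eq_true, if_false]
          refine h.trans ?_
          gcongr
          exact hΔ _
        · have h := avg3 A B (x := p.1) (y := p.2) (hB q hq)
          rw [hcard] at h
          simp only [xp, yp, hf, if_true]
          refine h.trans ?_
          gcongr
          exact hΔ _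
      simp only [mul_add, Finset.sum_add_distrib, Finset.sum_const, hcard, smul_eq_mul,
        ← Finset.mul_sum]
      nlinarith [Nat.mul_le_mul_left (K + 1) key]
    have upper : (N - 2) * ∑ σ, W σ ≤ c2 * ((N - 2) * A.card * B.card * T0 + (K + 1) *
        ((N - 2) * B.card * Dm + B.card ^ 2 * Dm + A.card ^ 2 * B.card * Δ)) := by
      have e1 : ∑ σ, W σ = ∑ p ∈ A, ∑ q ∈ B, ∑ σ ∈ P2 p.1 p.2 q.1 q.2,
          (T0 + (K + 1) * (deg A (xp fl p) + SS A B σ (xp fl p) (yp fl p))) := by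
        simp only [hW, conf, Finset.sum_filter]
        rw [Finset.sum_comm]
        refine Finset.sum_congr rfl fun p _ => ?_
        rw [← Finset.sum_filter]
        rw [← Finset.sum_fiberwise_of_maps_to (t := B)
          (g := fun σ : Equiv.Perm α => (σ p.1, σ p.2)) (by intro σ hσ; simpa using hσ)]
        refine Finset.sum_congr rfl fun q hq => ?_
        refine Finset.sum_congr ?_ fun _ _ => rfl
        ext σ
        simp only [P2, mem_filter, mem_univ, true_and]
        constructor
        · rintro ⟨_, rfl⟩; exact ⟨rfl, rfl⟩
        · rintro ⟨h1, h2⟩; rw [h1, h2]; exact ⟨hq, rfl⟩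
      rw [e1, Finset.mul_sum]
      calc _ ≤ ∑ p ∈ A, B.card * (c2 * ((N - 2) * (T0 + (K + 1) * deg A (xp fl p))
            + (K + 1) * (deg A (xp fl p) * B.card + Δ * A.card))) := by
            refine Finset.sum_le_sum fun p hp => ?_
            rw [Finset.mul_sum]
            refine (Finset.sum_le_card_nsmul _ _ _ (hper p hp)).trans (le_of_eq (by simp))
        _ = c2 * ((N - 2) * A.card * B.card * T0 + (K + 1) *
              (((N - 2) * B.card + B.card ^ 2) * ∑ p ∈ A, deg A (xp fl p)
                + A.card ^ 2 * B.card * Δ)) := by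
            have : ∀ p, B.card * (c2 * ((N - 2) * (T0 + (K + 1) * deg A (xp fl p))
              + (K + 1) * (deg A (xp fl p) * B.card + Δ * A.card)))
              = B.card * c2 * ((N - 2) * T0 + (K + 1) * (Δ * A.card))
                + (B.card * c2 * (K + 1) * ((N - 2) + B.card)) * deg A (xp fl p) := by
              intro p; ring
            simp only [this, Finset.sum_add_distrib, Finset.sum_const, ← Finset.mul_sum, smul_eq_mul]
            ring
        _ ≤ _ := by
            rw [← add_mul]
            gcongr
    have hc2pos : 0 < c2 := by
      rcases Nat.eq_zero_or_pos c2 with h | h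
      · rw [h, zero_mul] at hc2; exact absurd hc2.symm (Nat.factorial_ne_zero _)
      · exact h
    have h3 := (Nat.mul_le_mul_left (N - 2) lower).trans upper
    rw [← hc2] at h3
    have h4 : c2 * ((K + 1) * T0 * ((N - 1) * N) * (N - 2)) ≤ c2 * ((N - 2) * A.card * B.card * T0 + (K + 1) *
        ((N - 2) * B.card * Dm + B.card ^ 2 * Dm + A.card ^ 2 * B.card * Δ)) := by
      refine le_trans (le_of_eq ?_) h3
      ring
    exact absurd (Nat.le_of_mul_le_mul_left h4 hc2pos) (by omega)
end core

end partc2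

section partc3
open Finset
set_option linter.unusedSectionVars false

section core
variable {α : Type*} [Fintype α] [DecidableEq α]

/-- forbidden swap partners -/
def UU (A B : Finset (α × α)) (σ : Equiv.Perm α) (x : α) : Finset α :=
  univ.filter (fun z =>
    (∃ t, (x, t) ∈ A ∧ (σ z, σ t) ∈ B) ∨ (∃ t, (t, x) ∈ A ∧ (σ t, σ z) ∈ B) ∨
    (∃ s, (z, s) ∈ A ∧ (σ x, σ s) ∈ B) ∨ (∃ s, (s, z) ∈ A ∧ (σ s, σ x) ∈ B))

theorem card_UU_le (A B : Finset (α × α)) (hA : ∀ p ∈ A, p.1 ≠ p.2) (hB : ∀ p ∈ B, p.1 ≠ p.2)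
    (σ : Equiv.Perm α) (x y : α) (hxy : x ≠ y) :
    (UU A B σ x).card ≤ SS A B σ x y + deg A y + deg B (σ y) := by
  have h1 : (UU A B σ x).card ≤ ∑ r, hf A B x r (σ x) (σ r) := by
    have hsub : UU A B σ x ⊆ univ.biUnion (fun r =>
        ((if (x, r) ∈ A then (inN B (σ r)).image σ.symm else ∅) ∪
         (if (r, x) ∈ A then (outN B (σ r)).image σ.symm else ∅)) ∪
        (if (σ x, σ r) ∈ B then inN A r else ∅) ∪
        (if (σ r, σ x) ∈ B then outN A r else ∅)) := by
      intro z hz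
      simp only [UU, mem_filter, mem_univ, true_and] at hz
      simp only [mem_biUnion, mem_univ, true_and, mem_union]
      rcases hz with ⟨t, h1, h2⟩ | ⟨t, h1, h2⟩ | ⟨t, h1, h2⟩ | ⟨t, h1, h2⟩
      · refine ⟨t, Or.inl (Or.inl (Or.inl ?_))⟩
        rw [if_pos h1, mem_image]; exact ⟨σ z, mem_inN.2 h2, by simp⟩
      · refine ⟨t, Or.inl (Or.inl (Or.inr ?_))⟩
        rw [if_pos h1, mem_image]; exact ⟨σ z, mem_outN.2 h2, by simp⟩
      · refine ⟨t, Or.inl (Or.inr ?_)⟩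
        rw [if_pos h2]; exact mem_inN.2 h1
      · refine ⟨t, Or.inr ?_⟩
        rw [if_pos h2]; exact mem_outN.2 h1
    refine (card_le_card hsub).trans (card_biUnion_le.trans (sum_le_sum fun r _ => ?_))
    unfold hf
    refine (card_union_le _ _).trans (add_le_add ((card_union_le _ _).trans (add_le_add
      ((card_union_le _ _).trans (add_le_add ?_ ?_)) ?_)) ?_)
    · split_ifs
      · exact card_image_le
      · simp
    · split_ifs
      · exact card_image_le
      · simp
    · split_ifs <;> simp
    · split_ifs <;> simp
  refine h1.trans ?_
  have h2 : ∑ r, hf A B x r (σ x) (σ r) = SS A B σ x y +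
      (hf A B x x (σ x) (σ x) + hf A B x y (σ x) (σ y)) := by
    rw [← Finset.sum_pair (f := fun r => hf A B x r (σ x) (σ r)) hxy, SS, Finset.sum_sdiff (Finset.subset_univ _)]
  have h3 : hf A B x x (σ x) (σ x) = 0 := by
    have a1 : (x, x) ∉ A := fun h => hA _ h rfl
    have a2 : (σ x, σ x) ∉ B := fun h => hB _ h rfl
    simp [hf, a1, a2]
  have h4 : hf A B x y (σ x) (σ y) ≤ deg A y + deg B (σ y) := by
    unfold hf deg
    split_ifs <;> omega
  omega

theorem exists_small (A B : Finset (α × α)) (σ : Equiv.Perm α) (S : Finset α) (g c : ℕ)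
    (hg : g ≤ S.card) (h : 2 * (A.card + B.card) < g * c) :
    ∃ z ∈ S, deg A z + deg B (σ z) + 1 ≤ c := by
  by_contra hc
  push Not at hc
  have h1 : S.card * c ≤ ∑ z ∈ S, (deg A z + deg B (σ z)) := by
    rw [← smul_eq_mul, ← Finset.sum_const]
    exact Finset.sum_le_sum fun z hz => by have := hc z hz; omega
  have h2 : ∑ z ∈ S, (deg A z + deg B (σ z)) ≤ ∑ z, (deg A z + deg B (σ z)) :=
    Finset.sum_le_sum_of_subset (Finset.subset_univ _)
  have h2' : ∑ z, (deg A z + deg B (σ z)) = 2 * A.card + 2 * B.card := by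
    rw [Finset.sum_add_distrib, Equiv.sum_comp σ (fun z => deg B z), sum_deg, sum_deg]
  have h3 := Nat.mul_le_mul_right c hg
  omega

theorem repair (A B : Finset (α × α)) (hA : ∀ p ∈ A, p.1 ≠ p.2)
    (X0 : Finset α) (c g : ℕ) (hcg : 2 * (A.card + B.card) < g * c) :
    ∀ (k : ℕ) (E : Finset α) (σ : Equiv.Perm α), E.card = k → E ⊆ X0 →
      (∀ x ∈ E, ∀ t, ((x, t) ∈ A ∨ (t, x) ∈ A) → t ∈ X0) →
      (∀ p ∈ A, (σ p.1, σ p.2) ∈ B → p.1 ∈ E ∨ p.2 ∈ E) →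
      (∀ x ∈ E, (UU A B σ x ∪ X0).card + k * c + g ≤ Fintype.card α) →
      ∃ τ : Equiv.Perm α, ∀ p ∈ A, (τ p.1, τ p.2) ∉ B := by
  intro k
  induction k with
  | zero =>
    intro E σ hE _ _ hconf _
    rw [Finset.card_eq_zero] at hE
    subst hE
    exact ⟨σ, fun p hp h => by simpa using hconf p hp h⟩
  | succ k ih =>
    intro E σ hE hEX hN hconf hU
    obtain ⟨x, hx⟩ : E.Nonempty := by rw [← Finset.card_pos]; omega
    have hxc := hU x hx
    obtain ⟨z, hz, hzc⟩ := exists_small A B σ (UU A B σ x ∪ X0)ᶜ g c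
      (by rw [Finset.card_compl]; omega) hcg
    simp only [mem_compl, mem_union, not_or] at hz
    obtain ⟨hzU, hzX⟩ := hz
    have hxX := hEX hx
    have hzx : z ≠ x := by rintro rfl; exact hzX hxX
    simp only [UU, mem_filter, mem_univ, true_and, not_or, not_exists, not_and] at hzU
    obtain ⟨u1, u2, u3, u4⟩ := hzU
    set σ' : Equiv.Perm α := (Equiv.swap x z).trans σ with hσ'
    have sx : σ' x = σ z := by simp [hσ']
    have sz : σ' z = σ x := by simp [hσ']
    have so : ∀ t, t ≠ x → t ≠ z → σ' t = σ t := by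
      intro t h1 h2; simp [hσ', Equiv.swap_apply_of_ne_of_ne h1 h2]
    have hnx : ∀ t, ((x, t) ∈ A ∨ (t, x) ∈ A) → t ≠ x ∧ t ≠ z := by
      intro t ht
      refine ⟨?_, ?_⟩
      · rintro rfl; rcases ht with h | h <;> exact hA _ h rfl
      · rintro rfl; exact hzX (hN x hx _ ht)
    have hnz : ∀ t, ((z, t) ∈ A ∨ (t, z) ∈ A) → t ≠ x ∧ t ≠ z := by
      intro t ht
      refine ⟨?_, ?_⟩
      · rintro rfl; exact hzX (hN t hx _ ht.symm)
      · rintro rfl; rcases ht with h | h <;> exact hA _ h rfl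
    refine ih (E.erase x) σ' (by rw [Finset.card_erase_of_mem hx, hE]; rfl)
      ((Finset.erase_subset _ _).trans hEX)
      (fun y hy => hN y (Finset.mem_of_mem_erase hy)) ?_ ?_
    · rintro ⟨p, q⟩ hp hB
      dsimp only at hB ⊢
      have a1 : p ≠ x := by
        rintro rfl
        obtain ⟨h1, h2⟩ := hnx q (Or.inl hp)
        rw [sx, so q h1 h2] at hB
        exact u1 q hp hB
      have a2 : q ≠ x := by
        rintro rfl
        obtain ⟨h1, h2⟩ := hnx p (Or.inr hp)
        rw [sx, so p h1 h2] at hB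
        exact u2 p hp hB
      have a3 : p ≠ z := by
        rintro rfl
        obtain ⟨h1, h2⟩ := hnz q (Or.inl hp)
        rw [sz, so q h1 h2] at hB
        exact u3 q hp hB
      have a4 : q ≠ z := by
        rintro rfl
        obtain ⟨h1, h2⟩ := hnz p (Or.inr hp)
        rw [sz, so p h1 h2] at hB
        exact u4 p hp hB
      rw [so p a1 a3, so q a2 a4] at hB
      have := hconf _ hp hB
      simp only [mem_erase]
      tauto
    · intro y hy
      have hyx : y ≠ x := Finset.ne_of_mem_erase hy
      have hyE := Finset.mem_of_mem_erase hy
      have hyz : y ≠ z := by rintro rfl; exact hzX (hEX hyE)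
      have sy := so y hyx hyz
      have hsub : UU A B σ' y ∪ X0 ⊆ (UU A B σ y ∪ X0) ∪ ({z} ∪
          ((outN A z ∪ inN A z) ∪
            ((outN B (σ z)).image σ'.symm ∪ (inN B (σ z)).image σ'.symm))) := by
        intro w hw
        rw [mem_union] at hw
        by_cases hwX : w ∈ X0
        · simp [hwX]
        have hw := hw.resolve_right hwX
        by_cases hwz : w = z
        · simp [hwz]
        have hwx : w ≠ x := by rintro rfl; exact hwX hxX
        have sw := so w hwx hwz
        simp only [UU, mem_filter, mem_univ, true_and] at hw
        rcases hw with ⟨t, h1, h2⟩ | ⟨t, h1, h2⟩ | ⟨t, h1, h2⟩ | ⟨t, h1, h2⟩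
        · have htz : t ≠ z := by rintro rfl; exact hzX (hN y hyE _ (Or.inl h1))
          by_cases htx : t = x
          · rw [htx, sx] at h2
            have : w ∈ (inN B (σ z)).image σ'.symm :=
              mem_image.2 ⟨σ' w, mem_inN.2 h2, by simp⟩
            simp only [mem_union, this, or_true]
          · rw [sw, so t htx htz] at h2
            have : w ∈ UU A B σ y := by
              simp only [UU, mem_filter, mem_univ, true_and]; exact Or.inl ⟨t, h1, h2⟩
            simp only [mem_union, this, true_or]
        · have htz : t ≠ z := by rintro rfl; exact hzX (hN y hyE _ (Or.inr h1))
          by_cases htx : t = x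
          · rw [htx, sx] at h2
            have : w ∈ (outN B (σ z)).image σ'.symm :=
              mem_image.2 ⟨σ' w, mem_outN.2 h2, by simp⟩
            simp only [mem_union, this, or_true, true_or]
          · rw [sw, so t htx htz] at h2
            have : w ∈ UU A B σ y := by
              simp only [UU, mem_filter, mem_univ, true_and]; exact Or.inr (Or.inl ⟨t, h1, h2⟩)
            simp only [mem_union, this, true_or]
        · by_cases htz : t = z
          · rw [htz] at h1
            have : w ∈ inN A z := mem_inN.2 h1
            simp only [mem_union, this, or_true, true_or]
          by_cases htx : t = x
          · rw [htx] at h1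
            exact absurd (hN x hx _ (Or.inr h1)) hwX
          · rw [sy, so t htx htz] at h2
            have : w ∈ UU A B σ y := by
              simp only [UU, mem_filter, mem_univ, true_and]
              exact Or.inr (Or.inr (Or.inl ⟨t, h1, h2⟩))
            simp only [mem_union, this, true_or]
        · by_cases htz : t = z
          · rw [htz] at h1
            have : w ∈ outN A z := mem_outN.2 h1
            simp only [mem_union, this, or_true, true_or]
          by_cases htx : t = x
          · rw [htx] at h1
            exact absurd (hN x hx _ (Or.inl h1)) hwX
          · rw [sy, so t htx htz] at h2
            have : w ∈ UU A B σ y := by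
              simp only [UU, mem_filter, mem_univ, true_and]
              exact Or.inr (Or.inr (Or.inr ⟨t, h1, h2⟩))
            simp only [mem_union, this, true_or]
      have hc1 := card_le_card hsub
      have hc2 : (({z} : Finset α) ∪ ((outN A z ∪ inN A z) ∪
            ((outN B (σ z)).image σ'.symm ∪ (inN B (σ z)).image σ'.symm))).card ≤ c := by
        refine le_trans ?_ hzc
        have b1 := card_union_le ({z} : Finset α) ((outN A z ∪ inN A z) ∪
            ((outN B (σ z)).image σ'.symm ∪ (inN B (σ z)).image σ'.symm))
        have b2 := card_union_le (outN A z ∪ inN A z)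
            ((outN B (σ z)).image σ'.symm ∪ (inN B (σ z)).image σ'.symm)
        have b3 := card_union_le (outN A z) (inN A z)
        have b4 := card_union_le ((outN B (σ z)).image σ'.symm) ((inN B (σ z)).image σ'.symm)
        have b5 : ((outN B (σ z)).image σ'.symm).card ≤ (outN B (σ z)).card := card_image_le
        have b6 : ((inN B (σ z)).image σ'.symm).card ≤ (inN B (σ z)).card := card_image_le
        simp only [card_singleton] at b1
        unfold deg
        omega
      have hc3 := card_union_le (UU A B σ y ∪ X0) ({z} ∪
          ((outN A z ∪ inN A z) ∪
            ((outN B (σ z)).image σ'.symm ∪ (inN B (σ z)).image σ'.symm)))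
      have := hU y hyE
      have e : (k + 1) * c = k * c + c := by ring
      omega

theorem core (A B : Finset (α × α)) (hA : ∀ p ∈ A, p.1 ≠ p.2) (hB : ∀ p ∈ B, p.1 ≠ p.2)
    (fl : α × α → Bool) (Γ Δ Dm K T0 g c : ℕ) (hΓ : ∀ x, deg A x ≤ Γ) (hΔ : ∀ x, deg B x ≤ Δ)
    (hDm : ∑ p ∈ A, deg A (xp fl p) ≤ Dm)
    (hN : 3 ≤ Fintype.card α)
    (hmain : (Fintype.card α - 2) * A.card * B.card * T0 + (K + 1) *
        ((Fintype.card α - 2) * B.card * Dm + B.card ^ 2 * Dm + A.card ^ 2 * B.card * Δ)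
        < (K + 1) * T0 * ((Fintype.card α - 1) * Fintype.card α) * (Fintype.card α - 2))
    (hcg : 2 * (A.card + B.card) < g * c)
    (hroom : K + T0 + Γ + Δ + K * c + g ≤ Fintype.card α) :
    ∃ τ : Equiv.Perm α, ∀ p ∈ A, (τ p.1, τ p.2) ∉ B := by
  obtain ⟨σ, hK, hT⟩ := pick_perm A B hA hB fl Δ Dm K T0 hΔ hDm hN hmain
  set E := (conf A B σ).image (xp fl) with hE
  set X0 := (conf A B σ).biUnion (fun p => insert (xp fl p) (outN A (xp fl p) ∪ inN A (xp fl p)))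
    with hX0
  have hX0c : X0.card ≤ ∑ p ∈ conf A B σ, (1 + deg A (xp fl p)) := by
    refine card_biUnion_le.trans (sum_le_sum fun p _ => ?_)
    refine (card_insert_le _ _).trans ?_
    have := card_union_le (outN A (xp fl p)) (inN A (xp fl p))
    unfold deg; omega
  have hEc : E.card ≤ K := card_image_le.trans hK
  refine repair A B hA X0 c g hcg E.card E σ rfl ?_ ?_ ?_ ?_
  · intro x hx
    obtain ⟨p, hp, rfl⟩ := mem_image.1 hx
    exact mem_biUnion.2 ⟨p, hp, mem_insert_self _ _⟩
  · intro x hx t ht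
    obtain ⟨p, hp, rfl⟩ := mem_image.1 hx
    refine mem_biUnion.2 ⟨p, hp, mem_insert_of_mem ?_⟩
    rw [mem_union, mem_outN, mem_inN]; exact ht
  · intro p hp hb
    have hpc : p ∈ conf A B σ := mem_filter.2 ⟨hp, hb⟩
    have : xp fl p ∈ E := mem_image_of_mem _ hpc
    unfold xp at this
    split_ifs at this
    · exact Or.inl this
    · exact Or.inr this
  · intro x hx
    obtain ⟨p, hp, rfl⟩ := mem_image.1 hx
    have hpA : p ∈ A := (mem_filter.1 hp).1
    have hne : xp fl p ≠ yp fl p := by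
      unfold xp yp
      split_ifs
      · exact hA p hpA
      · exact (hA p hpA).symm
    have h1 := card_UU_le A B hA hB σ _ _ hne
    have h2 := hΓ (yp fl p)
    have h3 := hΔ (σ (yp fl p))
    have h4 := card_union_le (UU A B σ (xp fl p)) X0
    have h5 : SS A B σ (xp fl p) (yp fl p) ≤ ∑ p ∈ conf A B σ, SS A B σ (xp fl p) (yp fl p) :=
      Finset.single_le_sum (f := fun p => SS A B σ (xp fl p) (yp fl p)) (fun _ _ => Nat.zero_le _) hp
    rw [Finset.sum_add_distrib] at hT hX0c
    simp only [Finset.sum_const, smul_eq_mul, mul_one] at hX0c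
    have h6 := Nat.mul_le_mul_right c hEc
    omega
end core

end partc3

section partc4
open Finset
set_option linter.unusedSectionVars false

section core
variable {α : Type*} [Fintype α] [DecidableEq α]

def mfl (A : Finset (α × α)) (p : α × α) : Bool := decide (deg A p.1 ≤ deg A p.2)

theorem Dm_bound (A : Finset (α × α)) (L : ℕ) :
    L * ∑ p ∈ A, deg A (xp (mfl A) p) ≤ A.card * L ^ 2 + A.card ^ 2 := by
  classical
  set H := univ.filter (fun x => L ≤ deg A x) with hH
  have hpt : ∀ p ∈ A, 2 * (deg A (xp (mfl A) p) : ℤ) ≤ 2 * L +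
      if p.1 ∈ H ∧ p.2 ∈ H then ((deg A p.1 : ℤ) - L) + ((deg A p.2 : ℤ) - L) else 0 := by
    intro p _
    have e : deg A (xp (mfl A) p) = min (deg A p.1) (deg A p.2) := by
      unfold xp mfl
      by_cases h : deg A p.1 ≤ deg A p.2
      · simp [h]
      · simp [h]; omega
    rw [e]
    simp only [hH, mem_filter, mem_univ, true_and]
    split_ifs with h
    · omega
    · omega
  have hsum := Finset.sum_le_sum hpt
  rw [← Finset.mul_sum, Finset.sum_add_distrib, Finset.sum_const, ← Finset.sum_filter,
    Finset.sum_add_distrib] at hsum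
  have hsub : A.filter (fun p => p.1 ∈ H ∧ p.2 ∈ H) ⊆ H ×ˢ H := by
    intro p hp
    rw [mem_filter] at hp
    exact mem_product.2 hp.2
  have hHd : ∀ x ∈ H, (0 : ℤ) ≤ (deg A x : ℤ) - L := by
    intro x hx
    have := (mem_filter.1 hx).2
    omega
  have s1 : ∑ p ∈ A.filter (fun p => p.1 ∈ H ∧ p.2 ∈ H), ((deg A p.1 : ℤ) - L)
      ≤ H.card * ∑ x ∈ H, ((deg A x : ℤ) - L) := by
    refine (Finset.sum_le_sum_of_subset_of_nonneg hsub ?_).trans (le_of_eq ?_)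
    · intro p hp _; exact hHd _ (mem_product.1 hp).1
    · rw [Finset.sum_product]; simp only [Finset.sum_const, nsmul_eq_mul, ← Finset.mul_sum]
  have s2 : ∑ p ∈ A.filter (fun p => p.1 ∈ H ∧ p.2 ∈ H), ((deg A p.2 : ℤ) - L)
      ≤ H.card * ∑ x ∈ H, ((deg A x : ℤ) - L) := by
    refine (Finset.sum_le_sum_of_subset_of_nonneg hsub ?_).trans (le_of_eq ?_)
    · intro p hp _; exact hHd _ (mem_product.1 hp).2
    · rw [Finset.sum_product]; simp only [Finset.sum_const, nsmul_eq_mul]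
  have s3 : ∑ x ∈ H, ((deg A x : ℤ) - L) ≤ 2 * A.card - H.card * L := by
    rw [Finset.sum_sub_distrib, Finset.sum_const, nsmul_eq_mul]
    have : ∑ x ∈ H, deg A x ≤ 2 * A.card := by
      rw [← sum_deg]; exact Finset.sum_le_sum_of_subset (Finset.subset_univ _)
    have h' : (∑ x ∈ H, (deg A x : ℤ)) ≤ 2 * A.card := by exact_mod_cast this
    linarith
  have s4 : (H.card : ℤ) * ∑ x ∈ H, ((deg A x : ℤ) - L) ≤ H.card * (2 * A.card - H.card * L) :=
    mul_le_mul_of_nonneg_left s3 (by positivity)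
  rw [nsmul_eq_mul] at hsum
  have fin : (∑ p ∈ A, (deg A (xp (mfl A) p) : ℤ)) ≤ A.card * L + H.card * (2 * A.card - H.card * L) := by
    linarith
  have fin2 := mul_le_mul_of_nonneg_left fin (Int.natCast_nonneg L)
  have : (L : ℤ) * ∑ p ∈ A, (deg A (xp (mfl A) p) : ℤ) ≤ A.card * L ^ 2 + A.card ^ 2 := by
    nlinarith [sq_nonneg ((A.card : ℤ) - H.card * L)]
  exact_mod_cast this

def ind (A : Finset (α × α)) (S : Finset α) : Finset (α × α) :=
  A.filter (fun p => p.1 ∈ S ∧ p.2 ∈ S)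

theorem mem_ind {A : Finset (α × α)} {S : Finset α} {p : α × α} :
    p ∈ ind A S ↔ p ∈ A ∧ p.1 ∈ S ∧ p.2 ∈ S := by simp [ind]

theorem ind_mono (A : Finset (α × α)) {S T : Finset α} (h : S ⊆ T) : ind A S ⊆ ind A T := by
  intro p hp; rw [mem_ind] at *; exact ⟨hp.1, h hp.2.1, h hp.2.2⟩

theorem ind_sub (A : Finset (α × α)) (S : Finset α) : ind A S ⊆ A := Finset.filter_subset _ _

theorem ind_univ (A : Finset (α × α)) : ind A univ = A := by ext; simp [mem_ind]

theorem deg_mono {A B : Finset (α × α)} (h : A ⊆ B) (x : α) : deg A x ≤ deg B x := by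
  unfold deg
  refine add_le_add (card_le_card ?_) (card_le_card ?_)
  · intro y hy; rw [mem_outN] at *; exact h hy
  · intro y hy; rw [mem_inN] at *; exact h hy

def adj (A : Finset (α × α)) (x : α) : Finset α := outN A x ∪ inN A x

theorem mem_adj {A : Finset (α × α)} {x y : α} : y ∈ adj A x ↔ (x, y) ∈ A ∨ (y, x) ∈ A := by
  simp [adj, mem_outN, mem_inN]

theorem card_adj_le (A : Finset (α × α)) (x : α) : (adj A x).card ≤ deg A x := card_union_le _ _

theorem card_ind_erase (A : Finset (α × α)) (hA : ∀ p ∈ A, p.1 ≠ p.2) (S : Finset α) (x : α) :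
    (ind A (S.erase x)).card + deg (ind A S) x = (ind A S).card := by
  have h1 : (outN (ind A S) x).card = ((ind A S).filter (fun p => p.1 = x)).card := by
    refine Finset.card_bij (fun y _ => (x, y)) ?_ ?_ ?_
    · intro y hy; rw [mem_outN] at hy; simp [hy]
    · intro y _ z _ h; simpa using h
    · rintro ⟨a, b⟩ h
      simp only [mem_filter] at h
      obtain ⟨h, rfl⟩ := h
      exact ⟨b, mem_outN.2 h, rfl⟩
  have h2 : (inN (ind A S) x).card = ((ind A S).filter (fun p => p.2 = x)).card := by
    refine Finset.card_bij (fun y _ => (y, x)) ?_ ?_ ?_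
    · intro y hy; rw [mem_inN] at hy; simp [hy]
    · intro y _ z _ h; simpa using h
    · rintro ⟨a, b⟩ h
      simp only [mem_filter] at h
      obtain ⟨h, rfl⟩ := h
      exact ⟨a, mem_inN.2 h, rfl⟩
  have d1 : Disjoint ((ind A S).filter (fun p => p.1 = x)) ((ind A S).filter (fun p => p.2 = x)) := by
    rw [Finset.disjoint_left]
    intro p hp hq
    rw [mem_filter] at hp hq
    exact hA p (ind_sub _ _ hp.1) (hp.2.trans hq.2.symm)
  have d2 : Disjoint (ind A (S.erase x)) ((ind A S).filter (fun p => p.1 = x) ∪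
      (ind A S).filter (fun p => p.2 = x)) := by
    rw [Finset.disjoint_left]
    intro p hp hq
    simp only [mem_ind, mem_erase] at hp
    simp only [mem_union, mem_filter] at hq
    rcases hq with h | h
    · exact hp.2.1.1 h.2
    · exact hp.2.2.1 h.2
  rw [deg, h1, h2, ← card_union_of_disjoint d1, ← card_union_of_disjoint d2]
  congr 1
  ext p
  simp only [mem_union, mem_filter, mem_ind, mem_erase]
  tauto

theorem deg_ind_zero (A : Finset (α × α)) (S : Finset α) (x : α) (hx : x ∉ S) : deg (ind A S) x = 0 := by
  have h1 : outN (ind A S) x = ∅ := by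
    ext y; simp [mem_outN, mem_ind, hx]
  have h2 : inN (ind A S) x = ∅ := by
    ext y; simp [mem_inN, mem_ind, hx]
  simp [deg, h1, h2]

theorem greedy (A : Finset (α × α)) (hA : ∀ p ∈ A, p.1 ≠ p.2) (h : ℕ) (h0 : 0 < h) :
    ∀ (k : ℕ) (S : Finset α), S.card = k → ∃ Y ⊆ S,
      Y.card * h + (ind A (S \ Y)).card ≤ (ind A S).card ∧
      (∀ x, deg (ind A (S \ Y)) x < h) ∧ ∀ y ∈ Y, h ≤ deg A y := by
  intro k
  induction k with
  | zero =>
    intro S hS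
    rw [Finset.card_eq_zero] at hS; subst hS
    refine ⟨∅, by simp, by simp, ?_, by simp⟩
    intro x; rw [deg_ind_zero _ _ _ (by simp)]; exact h0
  | succ k ih =>
    intro S hS
    by_cases hx : ∃ x ∈ S, h ≤ deg (ind A S) x
    · obtain ⟨x, hxS, hx⟩ := hx
      obtain ⟨Y, hY, h1, h2, h3⟩ := ih (S.erase x) (by rw [card_erase_of_mem hxS, hS]; rfl)
      have e : S \ insert x Y = S.erase x \ Y := by
        ext z; simp only [mem_sdiff, mem_insert, mem_erase]; tauto
      have hxY : x ∉ Y := fun hh => by simpa using hY hh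
      refine ⟨insert x Y, ?_, ?_, ?_, ?_⟩
      · exact insert_subset hxS (hY.trans (erase_subset _ _))
      · rw [e, card_insert_of_notMem hxY, add_mul, one_mul]
        have := card_ind_erase A hA S x
        omega
      · rw [e]; exact h2
      · intro y hy
        rcases mem_insert.1 hy with rfl | hy
        · exact hx.trans (deg_mono (ind_sub _ _) _)
        · exact h3 y hy
    · push Not at hx
      refine ⟨∅, by simp, by simp, ?_, by simp⟩
      intro x
      rw [sdiff_empty]
      by_cases hxS : x ∈ S
      · exact hx x hxS
      · rw [deg_ind_zero _ _ _ hxS]; exact h0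

def Closed (A : Finset (α × α)) (C : Finset α) : Prop := ∀ p ∈ A, p.1 ∈ C ↔ p.2 ∈ C

def MinClosed (A : Finset (α × α)) (C : Finset α) : Prop :=
  Closed A C ∧ C.Nonempty ∧ ∀ D ⊆ C, Closed A D → D.Nonempty → D = C

def DTree (A : Finset (α × α)) (T : Finset α) : Prop :=
  MinClosed A T ∧ (ind A T).card + 1 = T.card

theorem exists_boundary {A : Finset (α × α)} {T S : Finset α} (hT : MinClosed A T) (hS : S ⊆ T)
    (hne : S.Nonempty) (hST : S ≠ T) : ∃ s ∈ S, ∃ z ∈ T, z ∉ S ∧ ((s, z) ∈ A ∨ (z, s) ∈ A) := by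
  have hnc : ¬ Closed A S := fun h => hST (hT.2.2 S hS h hne)
  unfold Closed at hnc
  push Not at hnc
  obtain ⟨⟨p, q⟩, hp, h⟩ := hnc
  have hc := hT.1 _ hp
  rcases h with ⟨h1, h2⟩ | ⟨h1, h2⟩
  · exact ⟨p, h1, q, hc.1 (hS h1), h2, Or.inl hp⟩
  · exact ⟨q, h2, p, hc.2 (hS h2), h1, Or.inr hp⟩

theorem grow {A : Finset (α × α)} {T : Finset α} (hT : MinClosed A T) :
    ∀ (k : ℕ) (S : Finset α), S ⊆ T → S.Nonempty → (T \ S).card = k →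
      (ind A S).card + T.card ≤ (ind A T).card + S.card := by
  intro k
  induction k with
  | zero =>
    intro S hS _ h
    rw [card_eq_zero, sdiff_eq_empty_iff_subset] at h
    rw [Subset.antisymm hS h]
  | succ k ih =>
    intro S hS hne h
    obtain ⟨s, hs, z, hz, hzS, harc⟩ := exists_boundary hT hS hne (by
      rintro rfl; simp at h)
    have h1 := ih (insert z S) (insert_subset hz hS) ⟨z, mem_insert_self _ _⟩ (by
      have : T \ insert z S = (T \ S).erase z := by
        ext w; simp only [mem_sdiff, mem_insert, mem_erase]; tauto
      rw [this, card_erase_of_mem (mem_sdiff.2 ⟨hz, hzS⟩), h]; rfl)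
    rw [card_insert_of_notMem hzS] at h1
    have h2 : (ind A S).card < (ind A (insert z S)).card := by
      apply card_lt_card
      refine ⟨ind_mono A (subset_insert _ _), fun hh => ?_⟩
      rcases harc with ha | ha
      · have := hh (mem_ind.2 ⟨ha, by simp [hs], by simp⟩)
        exact hzS (mem_ind.1 this).2.2
      · have := hh (mem_ind.2 ⟨ha, by simp, by simp [hs]⟩)
        exact hzS (mem_ind.1 this).2.1
    omega

theorem DTree.her {A : Finset (α × α)} {T S : Finset α} (hT : DTree A T) (hS : S ⊆ T)
    (hne : S.Nonempty) : (ind A S).card + 1 ≤ S.card := by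
  have := grow hT.1 _ S hS hne rfl
  have := hT.2
  omega

theorem closed_disjoint {A : Finset (α × α)} {S T : Finset α} (hS : MinClosed A S)
    (hT : MinClosed A T) (h : S ≠ T) : Disjoint S T := by
  by_contra hd
  rw [Finset.not_disjoint_iff_nonempty_inter] at hd
  have hc : Closed A (S ∩ T) := by
    intro p hp
    simp only [mem_inter, hS.1 p hp, hT.1 p hp]
  exact h ((hS.2.2 _ inter_subset_left hc hd).symm.trans (hT.2.2 _ inter_subset_right hc hd))

theorem forest (A : Finset (α × α)) : ∀ (k : ℕ) (C : Finset α), C.card = k → Closed A C →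
    ∃ F : Finset (Finset α), (∀ T ∈ F, T ⊆ C ∧ DTree A T) ∧ C.card ≤ (ind A C).card + F.card := by
  intro k
  induction k using Nat.strong_induction_on with
  | _ k ih =>
  intro C hk hC
  by_cases h0 : C.Nonempty
  swap
  · rw [not_nonempty_iff_eq_empty] at h0
    subst h0
    exact ⟨∅, by simp, by simp⟩
  by_cases hmin : ∀ D ⊆ C, Closed A D → D.Nonempty → D = C
  · have hM : MinClosed A C := ⟨hC, h0, hmin⟩
    obtain ⟨x, hx⟩ := h0
    have hg := grow hM _ {x} (by simpa using hx) (by simp) rfl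
    simp only [card_singleton] at hg
    by_cases he : (ind A C).card + 1 = C.card
    · exact ⟨{C}, by simp [DTree, hM, he], by simp [he]⟩
    · exact ⟨∅, by simp, by simp; omega⟩
  · push Not at hmin
    obtain ⟨D, hD, hDc, hDn, hne⟩ := hmin
    have hc2 : Closed A (C \ D) := by
      intro p hp
      simp only [mem_sdiff, hC p hp, hDc p hp]
    have hlt : D.card < C.card := card_lt_card (hD.ssubset_of_ne hne)
    have hcs := card_sdiff_add_card_eq_card hD
    have hDp := hDn.card_pos
    obtain ⟨F1, h1, h1'⟩ := ih D.card (by omega) D rfl hDc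
    obtain ⟨F2, h2, h2'⟩ := ih (C \ D).card (by omega) (C \ D) rfl hc2
    refine ⟨F1 ∪ F2, ?_, ?_⟩
    · intro T hT
      rcases mem_union.1 hT with h | h
      · exact ⟨(h1 T h).1.trans hD, (h1 T h).2⟩
      · exact ⟨(h2 T h).1.trans sdiff_subset, (h2 T h).2⟩
    · have hd : Disjoint F1 F2 := by
        rw [Finset.disjoint_left]
        intro T a b
        obtain ⟨x, hx⟩ := (h1 T a).2.1.2.1
        exact (mem_sdiff.1 ((h2 T b).1 hx)).2 ((h1 T a).1 hx)
      rw [card_union_of_disjoint hd]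
      have hd2 : Disjoint (ind A D) (ind A (C \ D)) := by
        rw [Finset.disjoint_left]
        intro p a b
        exact (mem_sdiff.1 (mem_ind.1 b).2.1).2 (mem_ind.1 a).2.1
      have hs : (ind A D ∪ ind A (C \ D)).card ≤ (ind A C).card :=
        card_le_card (union_subset (ind_mono A hD) (ind_mono A sdiff_subset))
      rw [card_union_of_disjoint hd2] at hs
      omega

theorem sum_card_le (F : Finset (Finset α)) (A : Finset (α × α)) (hF : ∀ T ∈ F, DTree A T) :
    (F.biUnion id).card = ∑ T ∈ F, T.card := by
  refine card_biUnion ?_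
  intro S hS T hT h
  exact closed_disjoint (hF S hS).1 (hF T hT).1 h

theorem closed_outN {A : Finset (α × α)} {T : Finset α} (hT : Closed A T) {x : α} (hx : x ∈ T) :
    outN (ind A T) x = outN A x := by
  ext y
  simp only [mem_outN, mem_ind]
  constructor
  · exact fun h => h.1
  · exact fun h => ⟨h, hx, (hT _ h).1 hx⟩

theorem closed_inN {A : Finset (α × α)} {T : Finset α} (hT : Closed A T) {x : α} (hx : x ∈ T) :
    inN (ind A T) x = inN A x := by
  ext y
  simp only [mem_inN, mem_ind]
  constructor
  · exact fun h => h.1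
  · exact fun h => ⟨h, (hT _ h).2 hx, hx⟩

theorem DTree.deg_le {A : Finset (α × α)} (hA : ∀ p ∈ A, p.1 ≠ p.2) {T : Finset α} (hT : DTree A T)
    {x : α} (hx : x ∈ T) : deg A x + 1 ≤ T.card := by
  have h := card_ind_erase A hA T x
  have e : deg (ind A T) x = deg A x := by
    unfold deg; rw [closed_outN hT.1.1 hx, closed_inN hT.1.1 hx]
  have := hT.2
  omega

theorem DTree.sink {A : Finset (α × α)} {T : Finset α} (hT : DTree A T) :
    ∃ x ∈ T, outN A x = ∅ := by
  by_contra hc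
  push Not at hc
  have h1 : T.card ≤ ∑ x ∈ T, (outN (ind A T) x).card := by
    rw [card_eq_sum_ones]
    refine sum_le_sum fun x hx => ?_
    rw [closed_outN hT.1.1 hx]; exact card_pos.2 (hc x hx)
  have h2 : ∑ x ∈ T, (outN (ind A T) x).card ≤ (ind A T).card := by
    rw [← sum_outN]; exact sum_le_sum_of_subset (subset_univ _)
  have := hT.2
  omega

theorem DTree.source {A : Finset (α × α)} {T : Finset α} (hT : DTree A T) :
    ∃ x ∈ T, inN A x = ∅ := by
  by_contra hc
  push Not at hc
  have h1 : T.card ≤ ∑ x ∈ T, (inN (ind A T) x).card := by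
    rw [card_eq_sum_ones]
    refine sum_le_sum fun x hx => ?_
    rw [closed_inN hT.1.1 hx]; exact card_pos.2 (hc x hx)
  have h2 : ∑ x ∈ T, (inN (ind A T) x).card ≤ (ind A T).card := by
    rw [← sum_inN]; exact sum_le_sum_of_subset (subset_univ _)
  have := hT.2
  omega

theorem DTree.leaf {A : Finset (α × α)} {T : Finset α} (hT : DTree A T) :
    ∃ x ∈ T, deg A x ≤ 1 := by
  by_contra hc
  push Not at hc
  have h1 : T.card * 2 ≤ ∑ x ∈ T, deg (ind A T) x := by
    rw [← smul_eq_mul, ← sum_const]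
    refine sum_le_sum fun x hx => ?_
    have := hc x hx
    unfold deg at this ⊢
    rw [closed_outN hT.1.1 hx, closed_inN hT.1.1 hx]; omega
  have h2 : ∑ x ∈ T, deg (ind A T) x ≤ 2 * (ind A T).card := by
    rw [← sum_deg]; exact sum_le_sum_of_subset (subset_univ _)
  have := hT.2
  omega
end core

end partc4

section partc5
open Finset
set_option linter.unusedSectionVars false

section core
variable {α : Type*} [Fintype α] [DecidableEq α]

/-- partial packing on `P` -/
def PP (A B : Finset (α × α)) (f : α → α) (P : Finset α) : Prop :=
  Set.InjOn f P ∧ ∀ p ∈ A, p.1 ∈ P → p.2 ∈ P → (f p.1, f p.2) ∉ B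

theorem PP.union {A B : Finset (α × α)} {f g : α → α} {P Q : Finset α} (hf : PP A B f P)
    (hg : PP A B g Q) (hd : Disjoint P Q) (hi : Disjoint (P.image f) (Q.image g))
    (h1 : ∀ x ∈ P, ∀ y ∈ Q, (x, y) ∈ A → (f x, g y) ∉ B)
    (h2 : ∀ x ∈ P, ∀ y ∈ Q, (y, x) ∈ A → (g y, f x) ∉ B) :
    ∃ h : α → α, PP A B h (P ∪ Q) ∧ (P ∪ Q).image h = P.image f ∪ Q.image g ∧
      (∀ x ∈ P, h x = f x) ∧ ∀ x ∈ Q, h x = g x := by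
  have e1 : ∀ x ∈ P, P.piecewise f g x = f x := fun x hx => Finset.piecewise_eq_of_mem _ _ _ hx
  have e2 : ∀ x ∈ Q, P.piecewise f g x = g x := fun x hx =>
    Finset.piecewise_eq_of_notMem _ _ _ (Finset.disjoint_right.1 hd hx)
  refine ⟨P.piecewise f g, ⟨?_, ?_⟩, ?_, e1, e2⟩
  · intro x hx y hy hxy
    simp only [coe_union, Set.mem_union, mem_coe] at hx hy
    rcases hx with hx | hx <;> rcases hy with hy | hy
    · rw [e1 x hx, e1 y hy] at hxy; exact hf.1 hx hy hxy
    · rw [e1 x hx, e2 y hy] at hxy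
      exact absurd (mem_image_of_mem g hy) (hxy ▸ Finset.disjoint_left.1 hi (mem_image_of_mem f hx))
    · rw [e2 x hx, e1 y hy] at hxy
      exact absurd (mem_image_of_mem g hx) (hxy ▸ Finset.disjoint_left.1 hi (mem_image_of_mem f hy))
    · rw [e2 x hx, e2 y hy] at hxy; exact hg.1 hx hy hxy
  · rintro ⟨x, y⟩ hp hx hy
    simp only [mem_union] at hx hy ⊢
    rcases hx with hx | hx <;> rcases hy with hy | hy
    · rw [e1 x hx, e1 y hy]; exact hf.2 _ hp hx hy
    · rw [e1 x hx, e2 y hy]; exact h1 x hx y hy hp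
    · rw [e2 x hx, e1 y hy]; exact h2 y hy x hx hp
    · rw [e2 x hx, e2 y hy]; exact hg.2 _ hp hx hy
  · rw [image_union, image_congr (fun x hx => e1 x hx), image_congr (fun x hx => e2 x hx)]

theorem PP.union_closed {A B : Finset (α × α)} {f g : α → α} {P Q : Finset α} (hf : PP A B f P)
    (hg : PP A B g Q) (hd : Disjoint P Q) (hi : Disjoint (P.image f) (Q.image g))
    (hc : Closed A P) :
    ∃ h : α → α, PP A B h (P ∪ Q) ∧ (P ∪ Q).image h = P.image f ∪ Q.image g ∧
      (∀ x ∈ P, h x = f x) ∧ ∀ x ∈ Q, h x = g x := by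
  refine PP.union hf hg hd hi ?_ ?_
  · intro x hx y hy hp
    exact absurd hy (Finset.disjoint_left.1 hd ((hc _ hp).1 hx))
  · intro x hx y hy hp
    exact absurd hy (Finset.disjoint_left.1 hd ((hc _ hp).2 hx))

theorem inj_of_card_le (S Q : Finset α) (h : S.card ≤ Q.card) :
    ∃ f : α → α, Set.InjOn f S ∧ ∀ x ∈ S, f x ∈ Q := by
  obtain ⟨e⟩ := Function.Embedding.nonempty_of_card_le (α := S) (β := Q) (by simpa using h)
  refine ⟨fun x => if hx : x ∈ S then (e ⟨x, hx⟩ : α) else x, ?_, ?_⟩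
  · intro x hx y hy hxy
    simp only [mem_coe] at hx hy
    simp only [hx, hy, dif_pos] at hxy
    have := e.injective (Subtype.ext hxy)
    simpa using this
  · intro x hx
    simp [hx]

theorem absorb_ext (A B : Finset (α × α)) (hA : ∀ p ∈ A, p.1 ≠ p.2) {T G : Finset α} {u X : α}
    (hT : DTree A T) (hXG : X ∉ G)
    (hdeg : ∀ w ∈ G, (adj B w ∩ G).card + T.card ≤ G.card) :
    ∀ (k : ℕ) (S : Finset α) (f : α → α), (T \ S).card = k → S ⊆ T → u ∈ S → adj A u ⊆ S →
      (ind A S).card + 1 = S.card → PP A B f S → f u = X → (∀ z ∈ S, z ≠ u → f z ∈ G) →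
      ∃ f : α → α, PP A B f T ∧ f u = X ∧ ∀ z ∈ T, z ≠ u → f z ∈ G := by
  intro k
  induction k with
  | zero =>
    intro S f hk hS _ _ _ hf hfu hfG
    rw [card_eq_zero, sdiff_eq_empty_iff_subset] at hk
    have := Subset.antisymm hS hk
    subst this
    exact ⟨f, hf, hfu, hfG⟩
  | succ k ih =>
    intro S f hk hS hu hadj hcard hf hfu hfG
    obtain ⟨s, hs, z, hz, hzS, harc⟩ := exists_boundary hT.1 hS ⟨u, hu⟩ (by rintro rfl; simp at hk)
    have hzu : z ≠ u := by rintro rfl; exact hzS hu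
    have hsu : s ≠ u := by
      rintro rfl; exact hzS (hadj (mem_adj.2 harc))
    have hins : (ind A (insert z S)).card + 1 ≤ (insert z S).card :=
      hT.her (insert_subset hz hS) ⟨z, mem_insert_self _ _⟩
    rw [card_insert_of_notMem hzS] at hins
    have hers := card_ind_erase A hA (insert z S) z
    rw [erase_insert hzS] at hers
    have hdz : deg (ind A (insert z S)) z ≤ 1 := by omega
    have hsadj : s ∈ adj (ind A (insert z S)) z := by
      rw [mem_adj]
      rcases harc with h | h
      · right; exact mem_ind.2 ⟨h, by simp [hs], by simp⟩
      · left; exact mem_ind.2 ⟨h, by simp, by simp [hs]⟩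
    have hac := card_adj_le (ind A (insert z S)) z
    have hpos : 0 < (adj (ind A (insert z S)) z).card := card_pos.2 ⟨s, hsadj⟩
    have huniq : ∀ s' ∈ S, ((z, s') ∈ A ∨ (s', z) ∈ A) → s' = s := by
      intro s' hs' h
      have : s' ∈ adj (ind A (insert z S)) z := by
        rw [mem_adj]
        rcases h with h | h
        · left; exact mem_ind.2 ⟨h, by simp, by simp [hs']⟩
        · right; exact mem_ind.2 ⟨h, by simp [hs'], by simp⟩
      exact card_le_one.1 (hac.trans hdz) _ this _ hsadj
    -- choose a spot
    have hwG := hfG s hs hsu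
    obtain ⟨w, hw⟩ : (G \ ((adj B (f s) ∩ G) ∪ (S.erase u).image f)).Nonempty := by
      rw [← card_pos]
      have h1 := le_card_sdiff ((adj B (f s) ∩ G) ∪ (S.erase u).image f) G
      have h2 := card_union_le (adj B (f s) ∩ G) ((S.erase u).image f)
      have h3 : ((S.erase u).image f).card ≤ (S.erase u).card := card_image_le
      rw [card_erase_of_mem hu] at h3
      have h4 := hdeg _ hwG
      have h5 : S.card < T.card := card_lt_card ⟨hS, fun h => hzS (h hz)⟩
      have : 0 < S.card := card_pos.2 ⟨u, hu⟩
      omega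
    simp only [mem_sdiff, mem_union, mem_inter, not_or, mem_image, mem_erase, not_exists, not_and] at hw
    obtain ⟨hwG', hwa, hwi⟩ := hw
    have hwadj : w ∉ adj B (f s) := fun h => hwa h hwG'
    rw [mem_adj, not_or] at hwadj
    have hwS : ∀ y ∈ S, f y ≠ w := by
      intro y hy h
      by_cases hyu : y = u
      · rw [hyu, hfu] at h; exact hXG (h ▸ hwG')
      · exact hwi y ⟨hyu, hy⟩ h
    have hup : ∀ y ∈ S, Function.update f z w y = f y := fun y hy =>
      Function.update_of_ne (by rintro rfl; exact hzS hy) _ _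
    refine ih (insert z S) (Function.update f z w) ?_ (insert_subset hz hS) (mem_insert_of_mem hu)
      (hadj.trans (subset_insert _ _)) ?_ ⟨?_, ?_⟩ ?_ ?_
    · have : T \ insert z S = (T \ S).erase z := by
        ext w; simp only [mem_sdiff, mem_insert, mem_erase]; tauto
      rw [this, card_erase_of_mem (mem_sdiff.2 ⟨hz, hzS⟩), hk]; rfl
    · rw [card_insert_of_notMem hzS]
      omega
    · intro x hx y hy hxy
      simp only [coe_insert, Set.mem_insert_iff, mem_coe] at hx hy
      rcases hx with rfl | hx <;> rcases hy with rfl | hy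
      · rfl
      · rw [Function.update_self, hup y hy] at hxy; exact absurd hxy.symm (hwS y hy)
      · rw [Function.update_self, hup x hx] at hxy; exact absurd hxy (hwS x hx)
      · rw [hup x hx, hup y hy] at hxy; exact hf.1 hx hy hxy
    · rintro ⟨x, y⟩ hp hx hy
      simp only [mem_insert] at hx hy ⊢
      rcases hx with hx | hx <;> rcases hy with hy | hy
      · exact absurd (hx.trans hy.symm) (hA _ hp)
      · subst hx
        have := huniq y hy (Or.inl hp)
        subst this
        rw [Function.update_self, hup y hy]; exact hwadj.2
      · subst hy
        have := huniq x hx (Or.inr hp)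
        subst this
        rw [Function.update_self, hup x hx]; exact hwadj.1
      · rw [hup x hx, hup y hy]; exact hf.2 _ hp hx hy
    · rw [hup u hu, hfu]
    · intro y hy hyu
      rcases mem_insert.1 hy with rfl | hy
      · rw [Function.update_self]; exact hwG'
      · rw [hup y hy]; exact hfG y hy hyu

theorem absorb (A B : Finset (α × α)) (hA : ∀ p ∈ A, p.1 ≠ p.2) {T G Q : Finset α} {u X : α}
    (hT : DTree A T) (hu : u ∈ T) (hXG : X ∉ G) (hQG : Q ⊆ G) (hQ : deg A u ≤ Q.card)
    (h1 : ∀ w ∈ Q, inN A u = ∅ ∨ (w, X) ∉ B) (h2 : ∀ w ∈ Q, outN A u = ∅ ∨ (X, w) ∉ B)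
    (hdeg : ∀ w ∈ G, (adj B w ∩ G).card + T.card ≤ G.card) :
    ∃ f : α → α, PP A B f T ∧ f u = X ∧ ∀ z ∈ T, z ≠ u → f z ∈ G := by
  have huadj : u ∉ adj A u := by
    rw [mem_adj]; rintro (h | h) <;> exact hA _ h rfl
  obtain ⟨f0, hf0, hf0Q⟩ := inj_of_card_le (adj A u) Q ((card_adj_le A u).trans hQ)
  have hadjT : adj A u ⊆ T := by
    intro y hy
    rcases mem_adj.1 hy with h | h
    · exact (hT.1.1 _ h).1 hu
    · exact (hT.1.1 _ h).2 hu
  set S := insert u (adj A u) with hS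
  have hST : S ⊆ T := insert_subset hu hadjT
  have hSc : S.card = (adj A u).card + 1 := card_insert_of_notMem huadj
  have her := hT.her hST ⟨u, mem_insert_self _ _⟩
  have hers := card_ind_erase A hA S u
  have hde : adj A u ⊆ adj (ind A S) u := by
    intro y hy
    have hyS : y ∈ S := mem_insert_of_mem hy
    rw [mem_adj] at hy ⊢
    rcases hy with h | h
    · exact Or.inl (mem_ind.2 ⟨h, mem_insert_self _ _, hyS⟩)
    · exact Or.inr (mem_ind.2 ⟨h, hyS, mem_insert_self _ _⟩)
  have hde2 := (card_le_card hde).trans (card_adj_le _ _)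
  have hempty : ind A (adj A u) = ∅ := by
    rw [← card_eq_zero]
    have hSe : S.erase u = adj A u := by rw [hS, erase_insert huadj]
    rw [hSe] at hers
    omega
  have hup : ∀ y ∈ adj A u, Function.update f0 u X y = f0 y := fun y hy =>
    Function.update_of_ne (by rintro rfl; exact huadj hy) _ _
  refine absorb_ext A B hA hT hXG hdeg _ S (Function.update f0 u X) rfl hST (mem_insert_self _ _)
    (subset_insert _ _) (by omega) ⟨?_, ?_⟩ (Function.update_self _ _ _) ?_
  · intro x hx y hy hxy
    simp only [hS, coe_insert, Set.mem_insert_iff, mem_coe] at hx hy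
    rcases hx with rfl | hx <;> rcases hy with rfl | hy
    · rfl
    · rw [Function.update_self, hup y hy] at hxy
      exact absurd (hQG (hf0Q y hy)) (hxy ▸ hXG)
    · rw [Function.update_self, hup x hx] at hxy
      exact absurd (hQG (hf0Q x hx)) (hxy ▸ hXG)
    · rw [hup x hx, hup y hy] at hxy; exact hf0 hx hy hxy
  · rintro ⟨x, y⟩ hp hx hy
    simp only [hS, mem_insert] at hx hy ⊢
    rcases hx with hx | hx <;> rcases hy with hy | hy
    · exact absurd (hx.trans hy.symm) (hA _ hp)
    · subst hx
      rw [Function.update_self, hup y hy]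
      refine (h2 _ (hf0Q y hy)).resolve_left fun h => ?_
      have := mem_outN.2 hp
      simp [h] at this
    · subst hy
      rw [Function.update_self, hup x hx]
      refine (h1 _ (hf0Q x hx)).resolve_left fun h => ?_
      have := mem_inN.2 hp
      simp [h] at this
    · have : (x, y) ∈ ind A (adj A u) := mem_ind.2 ⟨hp, hx, hy⟩
      simp [hempty] at this
  · intro z hz hzu
    have hz' := (mem_insert.1 hz).resolve_left hzu
    rw [hup z hz']; exact hQG (hf0Q z hz')

theorem closed_biUnion {A : Finset (α × α)} (F : Finset (Finset α)) (hF : ∀ T ∈ F, Closed A T) :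
    Closed A (F.biUnion id) := by
  intro p hp
  simp only [mem_biUnion, id]
  constructor
  · rintro ⟨T, hT, h⟩; exact ⟨T, hT, (hF T hT p hp).1 h⟩
  · rintro ⟨T, hT, h⟩; exact ⟨T, hT, (hF T hT p hp).2 h⟩

theorem multi (A B : Finset (α × α)) (hA : ∀ p ∈ A, p.1 ≠ p.2) :
    ∀ (k : ℕ) (V G : Finset α) (F : Finset (Finset α)), V.card = k → F.card = k →
      (∀ T ∈ F, DTree A T) → Disjoint V G →
      (∀ X ∈ V, ∑ T ∈ F, (T.card - 1) ≤ (G.filter (fun w => (w, X) ∉ B)).card ∨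
        ∑ T ∈ F, (T.card - 1) ≤ (G.filter (fun w => (X, w) ∉ B)).card) →
      (∀ w ∈ G, (adj B w ∩ G).card + ∑ T ∈ F, (T.card - 1) + 1 ≤ G.card) →
      ∃ f : α → α, PP A B f (F.biUnion id) ∧ V ⊆ (F.biUnion id).image f ∧
        (F.biUnion id).image f ⊆ V ∪ G := by
  intro k
  induction k with
  | zero =>
    intro V G F hV hF _ _ _ _
    rw [card_eq_zero] at hV hF
    subst hV; subst hF
    exact ⟨id, ⟨by simp, by simp⟩, by simp, by simp⟩
  | succ k ih =>
    intro V G F hV hF hTr hVG hside hdeg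
    obtain ⟨X, hX⟩ : V.Nonempty := by rw [← card_pos]; omega
    obtain ⟨T, hT⟩ : F.Nonempty := by rw [← card_pos]; omega
    have hsum := Finset.add_sum_erase F (fun T => T.card - 1) hT
    have hTt := hTr T hT
    have hXG : X ∉ G := Finset.disjoint_left.1 hVG hX
    have hTpos : 0 < T.card := card_pos.2 hTt.1.2.1
    obtain ⟨f, u, hu, hfP, hfu, hfG⟩ : ∃ (f : α → α) (u : α), u ∈ T ∧ PP A B f T ∧ f u = X ∧
        ∀ z ∈ T, z ≠ u → f z ∈ G := by
      rcases hside X hX with h | h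
      · obtain ⟨u, hu, hs⟩ := hTt.sink
        have hd := hTt.deg_le hA hu
        obtain ⟨f, h1, h2, h3⟩ := absorb A B hA (Q := G.filter (fun w => (w, X) ∉ B)) hTt hu hXG
          (filter_subset _ _) (by omega) (fun w hw => Or.inr (mem_filter.1 hw).2)
          (fun _ _ => Or.inl hs) (fun w hw => by have := hdeg w hw; omega)
        exact ⟨f, u, hu, h1, h2, h3⟩
      · obtain ⟨u, hu, hs⟩ := hTt.source
        have hd := hTt.deg_le hA hu
        obtain ⟨f, h1, h2, h3⟩ := absorb A B hA (Q := G.filter (fun w => (X, w) ∉ B)) hTt hu hXG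
          (filter_subset _ _) (by omega) (fun _ _ => Or.inl hs)
          (fun w hw => Or.inr (mem_filter.1 hw).2) (fun w hw => by have := hdeg w hw; omega)
        exact ⟨f, u, hu, h1, h2, h3⟩
    have hTi : (T.erase u).image f ⊆ G := by
      intro w hw
      obtain ⟨z, hz, rfl⟩ := mem_image.1 hw
      exact hfG z (mem_of_mem_erase hz) (ne_of_mem_erase hz)
    have hTimg : T.image f = insert X ((T.erase u).image f) := by
      rw [← hfu, ← image_insert, insert_erase hu]
    have hTc : ((T.erase u).image f).card ≤ T.card - 1 := by
      refine card_image_le.trans ?_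
      rw [card_erase_of_mem hu]
    set G' := G \ (T.erase u).image f with hG'
    have hG'c : G.card ≤ G'.card + (T.card - 1) := by
      have := le_card_sdiff ((T.erase u).image f) G
      rw [← hG'] at this
      omega
    have hfil : ∀ (P : α → Prop) [DecidablePred P], (G.filter P).card ≤ (G'.filter P).card + (T.card - 1) := by
      intro P _
      have : G.filter P ⊆ G'.filter P ∪ (T.erase u).image f := by
        intro w hw
        rw [mem_filter] at hw
        by_cases h : w ∈ (T.erase u).image f
        · exact mem_union_right _ h
        · exact mem_union_left _ (mem_filter.2 ⟨mem_sdiff.2 ⟨hw.1, h⟩, hw.2⟩)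
      have := (card_le_card this).trans (card_union_le _ _)
      omega
    obtain ⟨g, hgP, hgV, hgi⟩ := ih (V.erase X) G' (F.erase T)
      (by rw [card_erase_of_mem hX, hV]; rfl) (by rw [card_erase_of_mem hT, hF]; rfl)
      (fun S hS => hTr S (mem_of_mem_erase hS))
      (Finset.disjoint_of_subset_left (erase_subset _ _)
        (Finset.disjoint_of_subset_right sdiff_subset hVG))
      (by
        intro Y hY
        rcases hside Y (mem_of_mem_erase hY) with h | h
        · left; have := hfil (fun w => (w, Y) ∉ B); omega
        · right; have := hfil (fun w => (Y, w) ∉ B); omega)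
      (by
        intro w hw
        have h1 := hdeg w (sdiff_subset hw)
        have h2 : (adj B w ∩ G').card ≤ (adj B w ∩ G).card :=
          card_le_card (inter_subset_inter_left sdiff_subset)
        omega)
    have hdis : Disjoint T ((F.erase T).biUnion id) := by
      rw [Finset.disjoint_biUnion_right]
      intro S hS
      exact closed_disjoint hTt.1 (hTr S (mem_of_mem_erase hS)).1 (ne_of_mem_erase hS).symm
    have hidis : Disjoint (T.image f) (((F.erase T).biUnion id).image g) := by
      refine Finset.disjoint_of_subset_right hgi ?_
      rw [hTimg, Finset.disjoint_left]
      intro w hw hw2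
      rw [mem_union, mem_erase, hG', mem_sdiff] at hw2
      rcases mem_insert.1 hw with rfl | hw
      · rcases hw2 with h | h
        · exact h.1 rfl
        · exact hXG h.1
      · rcases hw2 with h | h
        · exact Finset.disjoint_left.1 hVG h.2 (hTi hw)
        · exact h.2 hw
    obtain ⟨h, hP, himg, -, -⟩ := PP.union_closed hfP hgP hdis hidis hTt.1.1
    have hF' : F.biUnion id = T ∪ (F.erase T).biUnion id := by
      conv_lhs => rw [← insert_erase hT, biUnion_insert]
      rfl
    refine ⟨h, hF' ▸ hP, ?_, ?_⟩
    · rw [hF', himg]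
      intro Y hY
      by_cases hYX : Y = X
      · apply mem_union_left; rw [hTimg, hYX]; exact mem_insert_self _ _
      · exact mem_union_right _ (hgV (mem_erase.2 ⟨hYX, hY⟩))
    · rw [hF', himg, hTimg]
      refine union_subset (insert_subset (mem_union_left _ hX) (hTi.trans subset_union_right)) ?_
      refine hgi.trans (union_subset_union (erase_subset _ _) sdiff_subset)

theorem avg_choose {β : Type*} [DecidableEq β] (w : β → ℕ) (j : ℕ) : ∀ (d : ℕ) (F : Finset β), F.card = j + d →
    ∃ S ⊆ F, S.card = j ∧ F.card * ∑ T ∈ S, w T ≤ j * ∑ T ∈ F, w T := by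
  intro d
  induction d with
  | zero => intro F h; exact ⟨F, Subset.rfl, h, by rw [h]; simp⟩
  | succ d ih =>
    intro F h
    obtain ⟨M, hM, hmax⟩ := exists_max_image F w (by rw [← card_pos]; omega)
    obtain ⟨S, hS, hSc, hle⟩ := ih (F.erase M) (by rw [card_erase_of_mem hM, h]; rfl)
    refine ⟨S, hS.trans (erase_subset _ _), hSc, ?_⟩
    have hsum := Finset.add_sum_erase F w hM
    have hb : ∑ T ∈ F, w T ≤ F.card * w M := by
      rw [← smul_eq_mul]; exact sum_le_card_nsmul _ _ _ hmax
    rw [card_erase_of_mem hM] at hle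
    rw [h] at hle hb ⊢
    simp only [Nat.add_sub_cancel, ← add_assoc] at *
    set k := j + d with hk
    rcases Nat.eq_zero_or_pos k with hk0 | hk0
    · have : j = 0 := by omega
      rw [this, card_eq_zero] at hSc
      simp [hSc]
    · apply Nat.le_of_mul_le_mul_left _ hk0
      set s := ∑ T ∈ S, w T
      set r := ∑ T ∈ F.erase M, w T
      rw [← hsum] at hb ⊢
      have h1 : r ≤ k * w M := by nlinarith
      calc k * ((k + 1) * s) = (k + 1) * (k * s) := by ring
        _ ≤ (k + 1) * (j * r) := Nat.mul_le_mul_left _ hle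
        _ = j * (k * r + r) := by ring
        _ ≤ j * (k * r + k * w M) := by gcongr
        _ = k * (j * (w M + r)) := by ring

theorem exists_indep (B : Finset (α × α)) (d : ℕ) : ∀ (k : ℕ) (S : Finset α), (d + 1) * k ≤ S.card →
    (∀ x ∈ S, (adj B x ∩ S).card ≤ d) →
    ∃ W ⊆ S, W.card = k ∧ ∀ x ∈ W, ∀ y ∈ W, x ≠ y → (x, y) ∉ B := by
  intro k
  induction k with
  | zero => intro S _ _; exact ⟨∅, by simp, by simp, by simp⟩
  | succ k ih =>
    intro S hS hd
    obtain ⟨x, hx⟩ : S.Nonempty := by rw [← card_pos]; nlinarith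
    have h1 := le_card_sdiff (insert x (adj B x ∩ S)) S
    have h2 := card_insert_le x (adj B x ∩ S)
    have h3 := hd x hx
    obtain ⟨W, hW, hWc, hWi⟩ := ih (S \ insert x (adj B x ∩ S)) (by
      have : (d + 1) * (k + 1) = (d + 1) * k + d + 1 := by ring
      omega) (by
      intro y hy
      refine (card_le_card (inter_subset_inter_left sdiff_subset)).trans (hd y (sdiff_subset hy)))
    have hn : ∀ y ∈ W, y ∈ S ∧ y ≠ x ∧ y ∉ adj B x := by
      intro y hy
      have := hW hy
      simp only [mem_sdiff, mem_insert, mem_inter, not_or, not_and] at this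
      exact ⟨this.1, this.2.1, fun h => this.2.2 h this.1⟩
    refine ⟨insert x W, insert_subset hx (hW.trans sdiff_subset), ?_, ?_⟩
    · rw [card_insert_of_notMem (fun h => (hn x h).2.1 rfl), hWc]
    · intro y hy z hz hyz
      rcases mem_insert.1 hy with rfl | hy' <;> rcases mem_insert.1 hz with rfl | hz'
      · exact absurd rfl hyz
      · exact fun h => (hn z hz').2.2 (mem_adj.2 (Or.inl h))
      · exact fun h => (hn y hy').2.2 (mem_adj.2 (Or.inr h))
      · exact hWi y hy' z hz' hyz
end core

end partc5

section partc6
open Finset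
set_option linter.unusedSectionVars false

section core
variable {α : Type*} [Fintype α] [DecidableEq α]

theorem deg_erase (B : Finset (α × α)) (S : Finset α) {x v : α} (hx : x ≠ v) :
    deg (ind B S) x ≤ deg (ind B (S.erase v)) x + 2 := by
  have h1 : outN (ind B S) x ⊆ insert v (outN (ind B (S.erase v)) x) := by
    intro y hy
    rw [mem_outN, mem_ind] at hy
    by_cases h : y = v
    · simp [h]
    · refine mem_insert_of_mem (mem_outN.2 (mem_ind.2 ⟨hy.1, ?_, ?_⟩))
      · exact mem_erase.2 ⟨hx, hy.2.1⟩
      · exact mem_erase.2 ⟨h, hy.2.2⟩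
  have h2 : inN (ind B S) x ⊆ insert v (inN (ind B (S.erase v)) x) := by
    intro y hy
    rw [mem_inN, mem_ind] at hy
    by_cases h : y = v
    · simp [h]
    · refine mem_insert_of_mem (mem_inN.2 (mem_ind.2 ⟨hy.1, ?_, ?_⟩))
      · exact mem_erase.2 ⟨h, hy.2.1⟩
      · exact mem_erase.2 ⟨hx, hy.2.2⟩
  have a1 := (card_le_card h1).trans (card_insert_le _ _)
  have a2 := (card_le_card h2).trans (card_insert_le _ _)
  unfold deg
  omega

theorem deg_le_card (B : Finset (α × α)) (hB : ∀ p ∈ B, p.1 ≠ p.2) (x : α) : deg B x ≤ B.card := by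
  have := card_ind_erase B hB univ x
  rw [ind_univ] at this
  omega

theorem deg_two (B : Finset (α × α)) (hB : ∀ p ∈ B, p.1 ≠ p.2) {x y : α} (h : x ≠ y) :
    deg B x + deg B y ≤ B.card + 2 := by
  have h1 := card_ind_erase B hB univ x
  have h2 := card_ind_erase B hB (univ.erase x) y
  have h3 := deg_erase B univ h.symm
  rw [ind_univ] at h1 h3
  omega

theorem deg_three (B : Finset (α × α)) (hB : ∀ p ∈ B, p.1 ≠ p.2) {x y z : α} (h : x ≠ y)
    (hz : z ≠ x) (hz' : z ≠ y) :
    deg B x + deg B y + deg B z ≤ B.card + 6 := by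
  have h1 := card_ind_erase B hB univ x
  have h2 := card_ind_erase B hB (univ.erase x) y
  have h2' := card_ind_erase B hB ((univ.erase x).erase y) z
  have h3 := deg_erase B univ h.symm
  have h4 := deg_erase B univ hz
  have h5 := deg_erase B (univ.erase x) hz'
  rw [ind_univ] at h1 h3 h4
  omega

theorem nonin_card (B : Finset (α × α)) (G : Finset α) (X : α) :
    G.card ≤ (G.filter (fun w => (w, X) ∉ B)).card + (inN B X).card := by
  have : G ⊆ G.filter (fun w => (w, X) ∉ B) ∪ inN B X := by
    intro w hw
    by_cases h : (w, X) ∈ B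
    · exact mem_union_right _ (mem_inN.2 h)
    · exact mem_union_left _ (mem_filter.2 ⟨hw, h⟩)
  exact (card_le_card this).trans (card_union_le _ _)

theorem nonout_card (B : Finset (α × α)) (G : Finset α) (X : α) :
    G.card ≤ (G.filter (fun w => (X, w) ∉ B)).card + (outN B X).card := by
  have : G ⊆ G.filter (fun w => (X, w) ∉ B) ∪ outN B X := by
    intro w hw
    by_cases h : (X, w) ∈ B
    · exact mem_union_right _ (mem_outN.2 h)
    · exact mem_union_left _ (mem_filter.2 ⟨hw, h⟩)
  exact (card_le_card this).trans (card_union_le _ _)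

theorem step1 (A B : Finset (α × α)) (hA : ∀ p ∈ A, p.1 ≠ p.2) (hB : ∀ p ∈ B, p.1 ≠ p.2)
    (n q : ℕ) (hn : Fintype.card α = n) (hn0 : 2883 ≤ n) (hq : 93 * q ≤ n)
    (hb : B.card + q + 1 ≤ 2 * n) {T : Finset α} (hT : DTree A T) (hTq : T.card ≤ q)
    (v : α) (hv : ∀ x, deg B x ≤ deg B v) :
    ∃ f : α → α, PP A B f T ∧ v ∈ T.image f := by
  have hTpos : 0 < T.card := card_pos.2 hT.1.2.1
  have hdv := deg_le_card B hB v
  have hdvd : deg B v = (outN B v).card + (inN B v).card := rfl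
  have adjle : ∀ (w : α) (G : Finset α), (adj B w ∩ G).card ≤ deg B w := fun w G =>
    (card_le_card inter_subset_left).trans (card_adj_le B w)
  by_cases hcase : (inN B v).card + q + 1 ≤ n ∨ (outN B v).card + q + 1 ≤ n
  · -- second vertex removed
    obtain ⟨v', hv', hmax⟩ := exists_max_image (univ.erase v) (deg B) (by
      rw [← card_pos, card_erase_of_mem (mem_univ _), card_univ]; omega)
    have hvv' : v' ≠ v := ne_of_mem_erase hv'
    set G := (univ.erase v).erase v' with hG
    have hGc : G.card = n - 2 := by
      rw [hG, card_erase_of_mem hv', card_erase_of_mem (mem_univ _), card_univ, hn]; omega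
    have hvG : v ∉ G := by simp [hG]
    have hdeg : ∀ w ∈ G, (adj B w ∩ G).card + T.card ≤ G.card := by
      intro w hw
      have h1 := adjle w G
      have hw1 : w ≠ v' := ne_of_mem_erase hw
      have hw2 : w ∈ univ.erase v := mem_of_mem_erase hw
      have h2 := deg_three B hB hvv'.symm (ne_of_mem_erase hw2) hw1
      have h3 := hmax w hw2
      have h4 := hv w
      omega
    rcases hcase with h | h
    · obtain ⟨u, hu, hs⟩ := hT.sink
      have hd := hT.deg_le hA hu
      have hc := nonin_card B G v
      obtain ⟨f, h1, h2, h3⟩ := absorb A B hA (Q := G.filter (fun w => (w, v) ∉ B)) hT hu hvG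
          (filter_subset _ _) (by omega) (fun w hw => Or.inr (mem_filter.1 hw).2)
          (fun _ _ => Or.inl hs) hdeg
      exact ⟨f, h1, h2 ▸ mem_image_of_mem f hu⟩
    · obtain ⟨u, hu, hs⟩ := hT.source
      have hd := hT.deg_le hA hu
      have hc := nonout_card B G v
      obtain ⟨f, h1, h2, h3⟩ := absorb A B hA (Q := G.filter (fun w => (v, w) ∉ B)) hT hu hvG
          (filter_subset _ _) (by omega) (fun _ _ => Or.inl hs)
          (fun w hw => Or.inr (mem_filter.1 hw).2) hdeg
      exact ⟨f, h1, h2 ▸ mem_image_of_mem f hu⟩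
  · push Not at hcase
    set G := univ.erase v with hG
    have hGc : G.card = n - 1 := by
      rw [hG, card_erase_of_mem (mem_univ _), card_univ, hn]
    have hvG : v ∉ G := by simp [hG]
    have hdeg : ∀ w ∈ G, (adj B w ∩ G).card + T.card ≤ G.card := by
      intro w hw
      have h1 := adjle w G
      have h2 := deg_two B hB (ne_of_mem_erase hw)
      omega
    have hci := nonin_card B G v
    have hco := nonout_card B G v
    by_cases hi : (inN B v).card + q ≤ n
    · obtain ⟨u, hu, hs⟩ := hT.sink
      have hd := hT.deg_le hA hu
      obtain ⟨f, h1, h2, h3⟩ := absorb A B hA (Q := G.filter (fun w => (w, v) ∉ B)) hT hu hvG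
          (filter_subset _ _) (by omega) (fun w hw => Or.inr (mem_filter.1 hw).2)
          (fun _ _ => Or.inl hs) hdeg
      exact ⟨f, h1, h2 ▸ mem_image_of_mem f hu⟩
    by_cases ho : (outN B v).card + q ≤ n
    · obtain ⟨u, hu, hs⟩ := hT.source
      have hd := hT.deg_le hA hu
      obtain ⟨f, h1, h2, h3⟩ := absorb A B hA (Q := G.filter (fun w => (v, w) ∉ B)) hT hu hvG
          (filter_subset _ _) (by omega) (fun _ _ => Or.inl hs)
          (fun w hw => Or.inr (mem_filter.1 hw).2) hdeg
      exact ⟨f, h1, h2 ▸ mem_image_of_mem f hu⟩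
    obtain ⟨u, hu, hl⟩ := hT.leaf
    by_cases hs : outN A u = ∅
    · obtain ⟨f, h1, h2, h3⟩ := absorb A B hA (Q := G.filter (fun w => (w, v) ∉ B)) hT hu hvG
          (filter_subset _ _) (by omega) (fun w hw => Or.inr (mem_filter.1 hw).2)
          (fun _ _ => Or.inl hs) hdeg
      exact ⟨f, h1, h2 ▸ mem_image_of_mem f hu⟩
    · have hs' : inN A u = ∅ := by
        have : 0 < (outN A u).card := card_pos.2 (nonempty_iff_ne_empty.2 hs)
        unfold deg at hl
        rw [← card_eq_zero]; omega
      obtain ⟨f, h1, h2, h3⟩ := absorb A B hA (Q := G.filter (fun w => (v, w) ∉ B)) hT hu hvG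
          (filter_subset _ _) (by omega) (fun _ _ => Or.inl hs')
          (fun w hw => Or.inr (mem_filter.1 hw).2) hdeg
      exact ⟨f, h1, h2 ▸ mem_image_of_mem f hu⟩

theorem step12 (A B : Finset (α × α)) (hA : ∀ p ∈ A, p.1 ≠ p.2) (hB : ∀ p ∈ B, p.1 ≠ p.2)
    (n q : ℕ) (hn : Fintype.card α = n) (hn0 : 2883 ≤ n) (hq : 93 * q ≤ n)
    (hb : B.card + q + 1 ≤ 2 * n) {T T' : Finset α} (hT : DTree A T) (hTq : T.card ≤ q)
    (hT' : DTree A T') (hT'n : 92 * T'.card ≤ n) (hTT : T ≠ T') :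
    ∃ f : α → α, PP A B f (T ∪ T') ∧ ∀ x, x ∉ (T ∪ T').image f → 3 * deg B x ≤ B.card + 6 := by
  have hne : (univ : Finset α).Nonempty := by rw [← card_pos, card_univ]; omega
  obtain ⟨v, -, hv⟩ := exists_max_image univ (deg B) hne
  obtain ⟨f, hf, hvf⟩ := step1 A B hA hB n q hn hn0 hq hb hT hTq v (fun x => hv x (mem_univ _))
  set R := univ \ T.image f with hR
  have hTi : (T.image f).card ≤ T.card := card_image_le
  have hRc : n ≤ R.card + T.card := by
    have := le_card_sdiff (T.image f) univ
    rw [card_univ, ← hR] at this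
    omega
  obtain ⟨v', hv'R, hv'⟩ := exists_max_image R (deg B) (by rw [← card_pos]; omega)
  have hvv : v ≠ v' := by
    rintro rfl; exact (mem_sdiff.1 hv'R).2 hvf
  have hd2 := deg_two B hB hvv
  have hd1 := hv v' (mem_univ _)
  have hGc : (R.erase v').card + 1 = R.card := card_erase_add_one hv'R
  obtain ⟨g, hg, hgV, hgi⟩ := multi A B hA 1 {v'} (R.erase v') {T'} (by simp) (by simp)
    (by simpa using hT') (by simp) (by
      intro X hX
      rw [mem_singleton] at hX
      subst hX
      rw [sum_singleton]
      have h1 := nonin_card B (R.erase X) X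
      have h2 := nonout_card B (R.erase X) X
      have h3 : deg B X = (outN B X).card + (inN B X).card := rfl
      omega) (by
      intro w hw
      rw [sum_singleton]
      have h1 : (adj B w ∩ R.erase v').card ≤ deg B w :=
        (card_le_card inter_subset_left).trans (card_adj_le B w)
      have hwR := mem_of_mem_erase hw
      have h2 := hv' w hwR
      have h3 := deg_three B hB hvv (z := w) (by rintro rfl; exact (mem_sdiff.1 hwR).2 hvf)
        (ne_of_mem_erase hw)
      omega)
  simp only [singleton_biUnion, id] at hg hgV hgi
  have hgR : T'.image g ⊆ R := hgi.trans (union_subset (by simpa using hv'R) (erase_subset _ _))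
  obtain ⟨h, hP, himg, -, -⟩ := PP.union_closed hf hg (closed_disjoint hT.1 hT'.1 hTT)
    (Finset.disjoint_of_subset_right hgR (by rw [hR]; exact disjoint_sdiff)) hT.1.1
  refine ⟨h, hP, ?_⟩
  intro x hx
  rw [himg, mem_union, not_or] at hx
  have hxR : x ∈ R := mem_sdiff.2 ⟨mem_univ _, hx.1⟩
  have h3 := deg_three B hB hvv (z := x) (by rintro rfl; exact hx.1 hvf)
    (by rintro rfl; exact hx.2 (hgV (by simp)))
  have h4 := hv' x hxR
  omega
end core

end partc6

section partc7
open Finset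
set_option linter.unusedSectionVars false

section core
variable {α : Type*} [Fintype α] [DecidableEq α]
variable {ι : Type*} [Fintype ι] [DecidableEq ι]

def pb (A : Finset (α × α)) (e : ι → α) : Finset (ι × ι) :=
  univ.filter (fun p => (e p.1, e p.2) ∈ A)

theorem pb_card (A : Finset (α × α)) (e : ι → α) (he : Function.Injective e) (R : Finset α)
    (hR : univ.image e = R) : (pb A e).card = (ind A R).card := by
  have : (pb A e).image (Prod.map e e) = ind A R := by
    ext ⟨x, y⟩
    subst hR
    simp only [mem_image, pb, mem_filter, mem_univ, true_and, Prod.exists, Prod.map_apply,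
      Prod.mk.injEq, mem_ind]
    constructor
    · rintro ⟨a, b, h, rfl, rfl⟩
      exact ⟨h, ⟨a, rfl⟩, ⟨b, rfl⟩⟩
    · rintro ⟨h, ⟨a, rfl⟩, ⟨b, rfl⟩⟩
      exact ⟨a, b, h, rfl, rfl⟩
  rw [← this, card_image_of_injective _ (he.prodMap he)]

theorem pb_deg (A : Finset (α × α)) (e : ι → α) (he : Function.Injective e) (R : Finset α)
    (hR : univ.image e = R) (x : ι) : deg (pb A e) x ≤ deg (ind A R) (e x) := by
  have hm : ∀ i, e i ∈ R := fun i => hR ▸ mem_image_of_mem e (mem_univ i)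
  unfold deg
  refine add_le_add ?_ ?_
  · rw [← card_image_of_injective (outN (pb A e) x) he]
    refine card_le_card ?_
    intro z hz
    obtain ⟨y, hy, rfl⟩ := mem_image.1 hz
    rw [mem_outN] at hy
    rw [mem_outN, mem_ind]
    exact ⟨(mem_filter.1 hy).2, hm _, hm _⟩
  · rw [← card_image_of_injective (inN (pb A e) x) he]
    refine card_le_card ?_
    intro z hz
    obtain ⟨y, hy, rfl⟩ := mem_image.1 hz
    rw [mem_inN] at hy
    rw [mem_inN, mem_ind]
    exact ⟨(mem_filter.1 hy).2, hm _, hm _⟩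

theorem core_on (A B : Finset (α × α)) (hA : ∀ p ∈ A, p.1 ≠ p.2) (hB : ∀ p ∈ B, p.1 ≠ p.2)
    (R R' : Finset α) (N a b : ℕ) (hR : R.card = N) (hR' : R'.card = N)
    (ha : (ind A R).card = a) (hb : (ind B R').card = b)
    (Γ Δ K T0 g c : ℕ) (hΓ : ∀ x, deg (ind A R) x ≤ Γ) (hΔ : ∀ x, deg (ind B R') x ≤ Δ)
    (hN : 3 ≤ N)
    (hmain : ∀ D, (∀ L, L * D ≤ a * L ^ 2 + a ^ 2) → (N - 2) * a * b * T0 +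
      (K + 1) * ((N - 2) * b * D + b ^ 2 * D + a ^ 2 * b * Δ) <
        (K + 1) * T0 * ((N - 1) * N) * (N - 2))
    (hcg : 2 * (a + b) < g * c) (hroom : K + T0 + Γ + Δ + K * c + g ≤ N) :
    ∃ f, PP A B f R ∧ R.image f = R' := by
  have e := (R.equivFinOfCardEq hR).symm
  have e' := (R'.equivFinOfCardEq hR').symm
  set i : Fin N → α := fun x => e x with hi
  set i' : Fin N → α := fun x => e' x with hi'
  have hij : Function.Injective i := Subtype.val_injective.comp e.injective
  have hij' : Function.Injective i' := Subtype.val_injective.comp e'.injective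
  have him : univ.image i = R := by
    ext x
    simp only [mem_image, mem_univ, true_and, hi]
    constructor
    · rintro ⟨a, rfl⟩
      exact (e a).2
    · intro hx
      exact ⟨e.symm ⟨x, hx⟩, by simp⟩
  have him' : univ.image i' = R' := by
    ext x
    simp only [mem_image, mem_univ, true_and, hi']
    constructor
    · rintro ⟨a, rfl⟩
      exact (e' a).2
    · intro hx
      exact ⟨e'.symm ⟨x, hx⟩, by simp⟩
  have ca := pb_card A i hij R him
  have cb := pb_card B i' hij' R' him'
  rw [ha] at ca
  rw [hb] at cb
  obtain ⟨τ, hτ⟩ := core (pb A i) (pb B i')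
    (fun p hp h => hA _ (mem_filter.1 hp).2 (congrArg i h))
    (fun p hp h => hB _ (mem_filter.1 hp).2 (congrArg i' h)) (mfl (pb A i)) Γ Δ
    (∑ p ∈ pb A i, deg (pb A i) (xp (mfl (pb A i)) p)) K T0 g c
    (fun x => (pb_deg A i hij R him x).trans (hΓ _))
    (fun x => (pb_deg B i' hij' R' him' x).trans (hΔ _)) le_rfl
    (by simpa using hN) (by
      rw [ca, cb, Fintype.card_fin]
      apply hmain
      intro L
      have := Dm_bound (pb A i) L
      rwa [ca] at this) (by rw [ca, cb]; exact hcg) (by simpa using hroom)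
  have hex : ∀ x, ∃ z, ∀ h : x ∈ R, z = i' (τ (e.symm ⟨x, h⟩)) := by
    intro x
    by_cases h : x ∈ R
    · exact ⟨i' (τ (e.symm ⟨x, h⟩)), fun _ => rfl⟩
    · exact ⟨x, fun h' => absurd h' h⟩
  choose f hf using hex
  have hfi : ∀ k, f (i k) = i' (τ k) := by
    intro k
    rw [hf (i k) (e k).2]
    simp [hi]
  have hsur : ∀ x ∈ R, ∃ k, i k = x := fun x hx => by
    rw [← him] at hx
    simpa using hx
  refine ⟨f, ⟨?_, ?_⟩, ?_⟩
  · intro x hx y hy h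
    obtain ⟨k, rfl⟩ := hsur x hx
    obtain ⟨l, rfl⟩ := hsur y hy
    rw [hfi, hfi] at h
    rw [τ.injective (hij' h)]
  · rintro ⟨x, y⟩ hp hx hy hq
    obtain ⟨k, rfl⟩ := hsur x hx
    obtain ⟨l, rfl⟩ := hsur y hy
    simp only at hq
    rw [hfi, hfi] at hq
    exact hτ (k, l) (mem_filter.2 ⟨mem_univ _, hp⟩) (mem_filter.2 ⟨mem_univ _, hq⟩)
  · rw [← him, image_image, ← him']
    ext z
    simp only [mem_image, mem_univ, true_and, Function.comp, hfi]
    constructor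
    · rintro ⟨k, rfl⟩
      exact ⟨_, rfl⟩
    · rintro ⟨k, rfl⟩
      exact ⟨τ.symm k, by simp⟩

end core

end partc7

section partc8
open Finset
set_option linter.unusedSectionVars false

def qQ : ℕ := 326240280
def qal (y : ℕ) : ℕ := qQ - 2878 * 18860 * y
def qbe (t : ℕ) : ℕ := 2 * qQ - 2864 * 5658 * t
def qmu (t y : ℕ) : ℕ := qQ - (3507960 + 3546090 + 113160 * (5 * y + t + 2)
  + (t + 4 * y) * (230 * (17298 - 2878 * y)))
def qta (t y : ℕ) : ℕ := qmu t y - (54373380 + 16312014 + 40780035 + 352 * 113160)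

def qchk1 (al be mu ta : ℕ) : Bool :=
  Nat.blt 0 mu && Nat.blt 0 ta && Nat.blt (al * be) (8 * mu * 326240280) &&
    Nat.blt (8 * al * be * (10 * mu * 326240280 + 10 * be * 326240280 + 13 * al * mu)
      + 260 * (ta * (al * be) * mu)) (260 * (ta * (8 * mu * 326240280) * mu))

def qchk (t y : ℕ) : Bool := qchk1 (qal y) (qbe t) (qmu t y) (qta t y)

theorem qchk_all : ([0, 1, 2, 3, 4, 5, 6, 7, 8, 9, 10, 11, 12, 13, 14, 15, 16, 17, 18, 19, 20, 21, 22, 23, 24, 25, 26, 27, 28, 29, 30, 31, 32, 33, 34, 35, 36, 37, 38, 39, 40].all fun t => [0, 1, 2, 3, 4, 5].all fun y => qchk t y) = true := by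
  decide +kernel

theorem fin_check_nat (t : ℕ) (ht : t < 41) (y : ℕ) (hy : y < 6) :
    0 < qmu t y ∧ 0 < qta t y ∧ qal y * qbe t < 8 * qmu t y * qQ ∧
    8 * qal y * qbe t * (10 * qmu t y * qQ + 10 * qbe t * qQ + 13 * qal y * qmu t y)
      + 260 * (qta t y * (qal y * qbe t) * qmu t y) <
      260 * (qta t y * (8 * qmu t y * qQ) * qmu t y) := by
  have h := List.all_eq_true.1 (List.all_eq_true.1 qchk_all t (by
    simp only [List.mem_cons]; omega)) y (by simp only [List.mem_cons]; omega)
  unfold qchk qchk1 at h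
  simp only [Bool.and_eq_true, Nat.blt_eq] at h
  obtain ⟨⟨⟨h1, h2⟩, h3⟩, h4⟩ := h
  exact ⟨h1, h2, h3, h4⟩

theorem fin_check (t y : ℕ) (ht : t < 41) (hy : y < 6) (al be mu ta : ℝ)
    (h1 : al = 1 - y / 6 * (2878/2883)) (h2 : be = 2 - t / 20 * (2864/2883))
    (h3 : mu = 1 - 1/93 - 1/92 - (5*y+t+2)/2883 - (t+4*y)/82*al)
    (h4 : ta = mu - (1/6+1/20+1/8+352/2883)) :
   0 ≤ al ∧ 0 ≤ be ∧ 0 < mu ∧ 0 < ta ∧ al * be < 8 * mu ∧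
   8*al*be*(mu/26+be/26+al*mu/20) < ta*(8*mu-al*be) * mu := by
  obtain ⟨k3, k4, k5, k6⟩ := fin_check_nat t ht y hy
  obtain ⟨q, hq⟩ : ∃ q : ℝ, q = 326240280 := ⟨_, rfl⟩
  have e1 : (qal y : ℝ) = q * al := by
    have : 2878 * 18860 * y ≤ 326240280 := by omega
    rw [hq, h1]; simp only [qal, qQ]; rw [Nat.cast_sub this]; push_cast; ring
  have e2 : (qbe t : ℝ) = q * be := by
    have : 2864 * 5658 * t ≤ 2 * 326240280 := by omega
    rw [hq, h2]; simp only [qbe, qQ]; rw [Nat.cast_sub this]; push_cast; ring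
  have e3 : (qmu t y : ℝ) = q * mu := by
    have h := (Nat.sub_pos_iff_lt.1 k3).le
    have h' : 2878 * y ≤ 17298 := by omega
    unfold qmu
    rw [Nat.cast_sub h, hq, h3, h1]; simp only [qQ]; push_cast [Nat.cast_sub h']; ring
  have e4 : (qta t y : ℝ) = q * ta := by
    have h := (Nat.sub_pos_iff_lt.1 k4).le
    unfold qta
    rw [Nat.cast_sub h, e3, hq, h4]; push_cast; ring
  have e5 : (qQ : ℝ) = q := by rw [hq]; simp [qQ]
  have j1 : (0:ℝ) ≤ qal y := Nat.cast_nonneg _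
  have j2 : (0:ℝ) ≤ qbe t := Nat.cast_nonneg _
  have j3 : (0:ℝ) < qmu t y := by exact_mod_cast k3
  have j4 : (0:ℝ) < qta t y := by exact_mod_cast k4
  have j5 : (qal y * qbe t : ℝ) < 8 * qmu t y * qQ := by exact_mod_cast k5
  have j6 : (8 * qal y * qbe t * (10 * qmu t y * qQ + 10 * qbe t * qQ + 13 * qal y * qmu t y)
      + 260 * (qta t y * (qal y * qbe t) * qmu t y) : ℝ) <
      260 * (qta t y * (8 * qmu t y * qQ) * qmu t y) := by exact_mod_cast k6
  rw [e1] at j1 j5 j6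
  rw [e2] at j2 j5 j6
  rw [e3] at j3 j5 j6
  rw [e4] at j4 j6
  rw [e5] at j5 j6
  have hq0 : 0 < q := by rw [hq]; norm_num
  clear e1 e2 e3 e4 e5 h1 h2 h3 h4
  clear hq k3 k4 k5 k6
  refine ⟨?_, ?_, ?_, ?_, ?_, ?_⟩
  · exact le_of_mul_le_mul_left (by simpa using j1) hq0
  · exact le_of_mul_le_mul_left (by simpa using j2) hq0
  · exact pos_of_mul_pos_right j3 hq0.le
  · exact pos_of_mul_pos_right j4 hq0.le
  · have : 0 < q ^ 2 * (8 * mu - al * be) := by linarith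
    have := pos_of_mul_pos_right this (by positivity)
    linarith
  · have : 0 < (260 * q ^ 4) * (ta*(8*mu-al*be) * mu - 8*al*be*(mu/26+be/26+al*mu/20)) := by
      refine (sub_pos.2 j6).trans_eq ?_
      ring
    have := pos_of_mul_pos_right this (by positivity)
    linarith

theorem num_real (n M T a b D al be mu ta Δ : ℝ) (hn : 0 < n) (hal : 0 ≤ al) (hbe : 0 ≤ be)
    (hmu : 0 < mu) (hta : 0 < ta) (h5 : al * be < 8 * mu)
    (h6 : 8*al*be*(mu/26+be/26+al*mu/20) < ta*(8*mu-al*be) * mu)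
    (ha0 : 0 ≤ a) (hb0 : 0 ≤ b) (hD0 : 0 ≤ D)
    (ha : a ≤ al * M) (hb : b ≤ be * n) (hD : 26 * D ≤ a * n) (hM : mu * n ≤ M)
    (hT : ta * n ≤ T) (hΔ : 20 * Δ ≤ n) (hΔ0 : 0 ≤ Δ) :
    M * a * b * T + 8 * (M * b * D + b ^ 2 * D + a ^ 2 * b * Δ) < 8 * T * M ^ 3 := by
  obtain ⟨x, rfl⟩ : ∃ x, M = x * n := ⟨M / n, by field_simp⟩
  obtain ⟨u, rfl⟩ : ∃ u, T = u * n := ⟨T / n, by field_simp⟩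
  have hx : mu ≤ x := le_of_mul_le_mul_right hM hn
  have hu : ta ≤ u := le_of_mul_le_mul_right hT hn
  have hx0 : 0 < x := hmu.trans_le hx
  have hu0 : 0 < u := hta.trans_le hu
  have hD' : D ≤ al * x * n ^ 2 / 26 := by
    have : a * n ≤ al * (x * n) * n := by gcongr
    linarith
  have hΔ' : Δ ≤ n / 20 := by linarith
  have ha' : a ≤ al * x * n := by linarith
  have s1 : x * n * a * b * (u * n) ≤ x * n * (al * x * n) * (be * n) * (u * n) := by gcongr
  have s2 : x * n * b * D ≤ x * n * (be * n) * (al * x * n ^ 2 / 26) := by gcongr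
  have s3 : b ^ 2 * D ≤ (be * n) ^ 2 * (al * x * n ^ 2 / 26) := by gcongr
  have s4 : a ^ 2 * b * Δ ≤ (al * x * n) ^ 2 * (be * n) * (n / 20) := by gcongr
  -- key scaled inequality
  have hxx : 8*al*be*(x/26+be/26+al*x/20) < u*(8*x-al*be) * x := by
    have p1 : ta * (8*mu-al*be) ≤ u * (8*x-al*be) := by
      have : 0 ≤ 8 * mu - al * be := by linarith
      gcongr
    have p2 : 8*al*be*(mu/26+be/26+al*mu/20) * x < ta*(8*mu-al*be) * mu * x := by gcongr
    have p3 : ta*(8*mu-al*be) * mu * x ≤ u * (8*x-al*be) * mu * x := by gcongr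
    have p4 : 8*al*be*(x/26+be/26+al*x/20) * mu ≤ 8*al*be*(mu/26+be/26+al*mu/20) * x := by
      have : 0 ≤ 8*al*be*(be/26) * (x - mu) := by
        have : 0 ≤ x - mu := by linarith
        positivity
      linarith
    have : 8*al*be*(x/26+be/26+al*x/20) * mu < (u*(8*x-al*be) * x) * mu := by
      have e' : u*(8*x-al*be)*mu*x = (u*(8*x-al*be) * x) * mu := by ring
      linarith
    exact lt_of_mul_lt_mul_right this hmu.le
  have hfin : 0 < (x * n ^ 4) * (u*(8*x-al*be) * x - 8*al*be*(x/26+be/26+al*x/20)) := by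
    have := sub_pos.2 hxx
    positivity
  linarith

theorem num_L (n L : ℕ) (hL1 : 54 * L ≤ n) (hL3 : 53 ≤ L) :
    26 * L ^ 2 + 26 * n ≤ n * L := by
  have h1 : 54 * L * (L - 26) ≤ n * (L - 26) := by gcongr
  obtain ⟨l, rfl⟩ : ∃ l, L = 26 + l := ⟨L - 26, by omega⟩
  have h2 : 27 ≤ l := by omega
  have h3 : 27 * l ≤ l * l := by gcongr
  rw [Nat.add_sub_cancel_left] at h1
  nlinarith

theorem num_D (n a D : ℕ) (hn : 2883 ≤ n) (han : a ≤ n) (hD : ∀ L, L * D ≤ a * L ^ 2 + a ^ 2) :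
    26 * D ≤ a * n := by
  obtain ⟨L, hL⟩ : ∃ L, L = n / 54 := ⟨_, rfl⟩
  have h := hD L
  have e1 := num_L n L (by omega) (by omega)
  have e2 : L * (26 * D) ≤ L * (a * n) := by
    calc L * (26 * D) = 26 * (L * D) := by ring
      _ ≤ 26 * (a * L ^ 2 + a ^ 2) := by gcongr
      _ = a * (26 * L ^ 2 + 26 * a) := by ring
      _ ≤ a * (26 * L ^ 2 + 26 * n) := by gcongr
      _ ≤ a * (n * L) := by gcongr
      _ = L * (a * n) := by ring
  exact Nat.le_of_mul_le_mul_left e2 (by omega)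

theorem numerics (n t y j s c1 c2 N a b : ℕ) (hn : 2883 ≤ n) (ht : t < 41) (hy : y < 6)
    (hj : j ≤ t + 4 * y) (hN : N + y + c1 + c2 + j + s = n) (hc1 : 93 * c1 ≤ n) (hc2 : 92 * c2 ≤ n)
    (hs : 82 * s + j * (y * (n / 6)) ≤ j * n) (ha : a + y * (n / 6) + 26 ≤ N)
    (hb : b + t * (n / 20) ≤ 2 * n) :
    3 ≤ N ∧ 7 + (N - n / 6 - n / 20 - n / 8 - 350) + n / 6 + n / 20 + 7 * 49 + n / 8 ≤ N ∧
    ∀ D, (∀ L, L * D ≤ a * L ^ 2 + a ^ 2) →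
     (N - 2) * a * b * (N - n / 6 - n / 20 - n / 8 - 350) +
      (7 + 1) * ((N - 2) * b * D + b ^ 2 * D + a ^ 2 * b * (n / 20)) <
        (7 + 1) * (N - n / 6 - n / 20 - n / 8 - 350) * ((N - 1) * N) * (N - 2) := by
  set Γ := n / 6 with hΓ
  set Δ := n / 20 with hΔ
  set g := n / 8 with hg
  obtain ⟨al, h1⟩ : ∃ al : ℝ, al = 1 - y / 6 * (2878/2883) := ⟨_, rfl⟩
  obtain ⟨be, h2⟩ : ∃ be : ℝ, be = 2 - t / 20 * (2864/2883) := ⟨_, rfl⟩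
  obtain ⟨mu, h3⟩ : ∃ mu : ℝ, mu = 1 - 1/93 - 1/92 - (5*y+t+2)/2883 - (t+4*y)/82*al := ⟨_, rfl⟩
  obtain ⟨ta, h4⟩ : ∃ ta : ℝ, ta = mu - (1/6+1/20+1/8+352/2883) := ⟨_, rfl⟩
  obtain ⟨k1, k2, k3, k4, k5, k6⟩ := fin_check t y ht hy al be mu ta h1 h2 h3 h4
  have rn : (2883 : ℝ) ≤ n := by exact_mod_cast hn
  have rj : (j : ℝ) ≤ t + 4 * y := by exact_mod_cast hj
  have rN : (N : ℝ) + y + c1 + c2 + j + s = n := by exact_mod_cast hN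
  have rc1 : 93 * (c1 : ℝ) ≤ n := by exact_mod_cast hc1
  have rc2 : 92 * (c2 : ℝ) ≤ n := by exact_mod_cast hc2
  have rs : 82 * (s : ℝ) + j * (y * Γ) ≤ j * n := by exact_mod_cast hs
  have ra : (a : ℝ) + y * Γ + 26 ≤ N := by exact_mod_cast ha
  have rb : (b : ℝ) + t * Δ ≤ 2 * n := by exact_mod_cast hb
  have rΓ1 : (n : ℝ) ≤ 6 * Γ + 5 := by
    have : n ≤ 6 * Γ + 5 := by omega
    exact_mod_cast this
  have rΓ2 : 6 * (Γ : ℝ) ≤ n := by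
    have : 6 * Γ ≤ n := by omega
    exact_mod_cast this
  have rΔ1 : (n : ℝ) ≤ 20 * Δ + 19 := by
    have : n ≤ 20 * Δ + 19 := by omega
    exact_mod_cast this
  have rΔ2 : 20 * (Δ : ℝ) ≤ n := by
    have : 20 * Δ ≤ n := by omega
    exact_mod_cast this
  have rg2 : 8 * (g : ℝ) ≤ n := by
    have : 8 * g ≤ n := by omega
    exact_mod_cast this
  have rΓ : 1 / 6 * (2878 / 2883) * (n : ℝ) ≤ Γ := by linarith
  have rΔ : 1 / 20 * (2864 / 2883) * (n : ℝ) ≤ Δ := by linarith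
  have ry0 : (0 : ℝ) ≤ y := by positivity
  have rt0 : (0 : ℝ) ≤ t := by positivity
  have rj0 : (0 : ℝ) ≤ j := by positivity
  have hyΓ : (n : ℝ) - y * Γ ≤ al * n := by
    have : y * (1 / 6 * (2878 / 2883) * (n : ℝ)) ≤ y * Γ := by gcongr
    rw [h1]
    linarith
  have rs' : (s : ℝ) ≤ (t + 4 * y) / 82 * al * n := by
    have q1 : 82 * (s : ℝ) ≤ j * (al * n) := by
      have : (j : ℝ) * (n - y * Γ) ≤ j * (al * n) := by gcongr
      linarith
    have q2 : (j : ℝ) * (al * n) ≤ (t + 4 * y) * (al * n) := by gcongr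
    linarith
  have hM : mu * n ≤ (N : ℝ) - 2 := by
    have q : ((5 * y + t + 2 : ℝ)) ≤ (5 * y + t + 2) / 2883 * n := by
      have : (5 * y + t + 2 : ℝ) / 2883 * 2883 ≤ (5 * y + t + 2) / 2883 * n := by gcongr
      linarith
    have : mu * n = n - n / 93 - n / 92 - (5 * y + t + 2) / 2883 * n
        - (t + 4 * y) / 82 * al * n := by rw [h3]; ring
    rw [this]
    linarith
  have hT : ta * n ≤ (N : ℝ) - Γ - Δ - g - 350 := by
    have : ta * n = mu * n - (1/6+1/20+1/8) * n - 352/2883 * n := by rw [h4]; ring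
    rw [this]
    linarith
  have hn0 : (0 : ℝ) < n := by linarith
  have htn : 0 < ta * n := by positivity
  have hT' : Γ + Δ + g + 350 ≤ N := by
    have : (Γ + Δ + g + 350 : ℝ) ≤ N := by linarith
    exact_mod_cast this
  refine ⟨by omega, by omega, ?_⟩
  intro D hD
  have ra' : (a : ℝ) ≤ al * ((N : ℝ) - 2) := by
    have hNn : ((N : ℝ) - 2) ≤ n := by
      have : (0:ℝ) ≤ c1 ∧ (0:ℝ) ≤ c2 ∧ (0:ℝ) ≤ s := ⟨by positivity, by positivity, by positivity⟩
      linarith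
    have hN0 : 0 ≤ ((N : ℝ) - 2) := le_trans (by positivity) hM
    have : (y : ℝ) / 6 * (2878 / 2883) * ((N : ℝ) - 2) ≤ y * Γ := by
      calc (y : ℝ) / 6 * (2878 / 2883) * ((N : ℝ) - 2) ≤ (y : ℝ) / 6 * (2878 / 2883) * n := by gcongr
        _ = y * (1 / 6 * (2878 / 2883) * (n : ℝ)) := by ring
        _ ≤ y * Γ := by gcongr
    rw [h1]
    linarith
  have rb' : (b : ℝ) ≤ be * n := by
    have : t * (1 / 20 * (2864 / 2883) * (n : ℝ)) ≤ t * Δ := by gcongr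
    rw [h2]
    linarith
  have rD : 26 * (D : ℝ) ≤ a * n := by
    have := num_D n a D hn (by omega) hD
    exact_mod_cast this
  have key := num_real n ((N : ℝ) - 2) ((N : ℝ) - Γ - Δ - g - 350) a b D al be mu ta Δ hn0 k1 k2 k3 k4 k5 k6
    (by positivity) (by positivity) (by positivity) ra' rb' rD hM hT rΔ2 (by positivity)
  obtain ⟨T, hTe⟩ : ∃ T, N = Γ + Δ + g + 350 + T := ⟨_, (Nat.add_sub_of_le hT').symm⟩
  have eT : N - Γ - Δ - g - 350 = T := by omega
  rw [eT]
  have eTr : ((N : ℝ) - Γ - Δ - g - 350) = T := by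
    rw [hTe]; push_cast; ring
  rw [eTr] at key
  obtain ⟨M, hMe⟩ : ∃ M, N = M + 2 := ⟨N - 2, by omega⟩
  have eMr : ((N : ℝ) - 2) = M := by
    rw [hMe]; push_cast; ring
  rw [eMr] at key
  have e1 : N - 2 = M := by omega
  have e2 : N - 1 = M + 1 := by omega
  rw [e1, e2, hMe]
  have key' : M * a * b * T + 8 * (M * b * D + b ^ 2 * D + a ^ 2 * b * Δ) < 8 * T * M ^ 3 := by
    exact_mod_cast key
  refine lt_of_lt_of_le key' ?_
  have : M ^ 3 ≤ (M + 1) * (M + 2) * M := by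
    calc M ^ 3 = M * M * M := by ring
      _ ≤ (M + 1) * (M + 2) * M := by gcongr <;> omega
  calc 8 * T * M ^ 3 ≤ 8 * T * ((M + 1) * (M + 2) * M) := by gcongr
    _ = (7 + 1) * T * ((M + 1) * (M + 2)) * M := by ring

end partc8

section partc9
open Finset
set_option linter.unusedSectionVars false

section core
variable {α : Type*} [Fintype α] [DecidableEq α]

theorem ind_disj_add (A : Finset (α × α)) {R C S : Finset α} (hd : Disjoint R C) (hR : R ⊆ S)
    (hC : C ⊆ S) : (ind A R).card + (ind A C).card ≤ (ind A S).card := by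
  rw [← card_union_of_disjoint]
  · exact card_le_card (union_subset (ind_mono A hR) (ind_mono A hC))
  · rw [Finset.disjoint_left]
    intro p hp hp'
    exact Finset.disjoint_left.1 hd (mem_ind.1 hp).2.1 (mem_ind.1 hp').2.1

theorem tree_arcs (A : Finset (α × α)) (F : Finset (Finset α)) (hF : ∀ T ∈ F, DTree A T) :
    (F.biUnion id).card ≤ (ind A (F.biUnion id)).card + F.card := by
  have h1 : (F.biUnion (fun T => ind A T)).card = ∑ T ∈ F, (ind A T).card := by
    refine card_biUnion ?_
    intro S hS T hT h
    show Disjoint (ind A S) (ind A T)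
    rw [Finset.disjoint_left]
    intro p hp hp'
    exact Finset.disjoint_left.1 (closed_disjoint (hF S hS).1 (hF T hT).1 h)
      (mem_ind.1 hp).2.1 (mem_ind.1 hp').2.1
  have h2 : F.biUnion (fun T => ind A T) ⊆ ind A (F.biUnion id) := by
    intro p hp
    obtain ⟨T, hT, h⟩ := mem_biUnion.1 hp
    exact ind_mono A (subset_biUnion_of_mem id hT) h
  have h3 := card_le_card h2
  rw [h1] at h3
  rw [sum_card_le F A hF]
  have : ∑ T ∈ F, T.card = ∑ T ∈ F, (ind A T).card + F.card := by
    rw [card_eq_sum_ones, ← sum_add_distrib]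
    exact sum_congr rfl (fun T hT => (hF T hT).2.symm)
  omega

theorem sum_pred (A : Finset (α × α)) (F : Finset (Finset α)) (hF : ∀ T ∈ F, DTree A T) :
    (F.biUnion id).card = ∑ T ∈ F, (T.card - 1) + F.card := by
  rw [sum_card_le F A hF, card_eq_sum_ones F, ← sum_add_distrib]
  refine sum_congr rfl (fun T hT => ?_)
  have := (hF T hT).2
  omega

theorem stage_trees (A : Finset (α × α)) (n m q : ℕ) (hn : Fintype.card α = n)
    (hm : 93 ≤ m) (hmn : 31 * m ≤ n) (hq : q = n / m) (ha : A.card = n - m) :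
    ∃ T1 T2 : Finset α, ∃ 𝒢 : Finset (Finset α), DTree A T1 ∧ DTree A T2 ∧ T1 ≠ T2 ∧
      T1.card ≤ q ∧ 92 * T2.card ≤ n ∧ T1 ∉ 𝒢 ∧ T2 ∉ 𝒢 ∧ 82 ≤ 𝒢.card ∧
      ∀ T ∈ 𝒢, DTree A T ∧ 10 * T.card ≤ n := by
  obtain ⟨F, hF, hFc⟩ := forest A _ univ rfl (fun p _ => by simp)
  rw [ind_univ, card_univ, hn, ha] at hFc
  have hFm : m ≤ F.card := by omega
  have hle : ∀ F' ⊆ F, ∑ T ∈ F', T.card ≤ n := by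
    intro F' h
    rw [← sum_card_le F' A (fun T hT => (hF T (h hT)).2), ← hn]
    exact card_le_univ _
  obtain ⟨T1, hT1, h1⟩ := exists_min_image F card (by rw [← card_pos]; omega)
  have c1 : T1.card * m ≤ n := by
    have := card_nsmul_le_sum F card T1.card h1
    have h2 := hle F Subset.rfl
    rw [smul_eq_mul] at this
    calc T1.card * m ≤ T1.card * F.card := by gcongr
      _ = F.card * T1.card := mul_comm _ _
      _ ≤ n := this.trans h2
  have e1 : (F.erase T1).card = F.card - 1 := card_erase_of_mem hT1
  obtain ⟨T2, hT2, h2⟩ := exists_min_image (F.erase T1) card (by rw [← card_pos]; omega)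
  have c2 : 92 * T2.card ≤ n := by
    have := card_nsmul_le_sum (F.erase T1) card T2.card h2
    have h2 := hle (F.erase T1) (erase_subset _ _)
    rw [smul_eq_mul] at this
    calc 92 * T2.card ≤ (F.erase T1).card * T2.card := by gcongr; omega
      _ ≤ n := this.trans h2
  have e2 : ((F.erase T1).erase T2).card = F.card - 1 - 1 := by
    rw [card_erase_of_mem hT2, e1]
  have hsub : (F.erase T1).erase T2 ⊆ F := (erase_subset _ _).trans (erase_subset _ _)
  refine ⟨T1, T2, ((F.erase T1).erase T2).filter (fun T => 10 * T.card ≤ n), (hF _ hT1).2,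
    (hF _ (mem_of_mem_erase hT2)).2, (ne_of_mem_erase hT2).symm, ?_, c2, ?_, ?_, ?_, ?_⟩
  · rw [hq]; exact (Nat.le_div_iff_mul_le (by omega)).2 c1
  · simp
  · simp
  · have h3 := card_filter_add_card_filter_not (s := (F.erase T1).erase T2)
      (fun T => 10 * T.card ≤ n)
    set Z := ((F.erase T1).erase T2).filter (fun T => ¬ 10 * T.card ≤ n) with hZ
    have h4 : Z.card ≤ 9 := by
      have h5 := card_nsmul_le_sum Z (fun T => 10 * T.card) (n + 1) (fun T hT => by
        have := (mem_filter.1 hT).2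
        omega)
      rw [← mul_sum, smul_eq_mul] at h5
      have h6 := hle Z ((filter_subset _ _).trans hsub)
      by_contra hc
      have : 10 * (n + 1) ≤ Z.card * (n + 1) := by gcongr; omega
      omega
    omega
  · intro T hT
    exact ⟨(hF T (hsub (mem_filter.1 hT).1)).2, (mem_filter.1 hT).2⟩

theorem stage_B (B : Finset (α × α)) (hB : ∀ p ∈ B, p.1 ≠ p.2) (n y c : ℕ)
    (hn0 : 2883 ≤ n) (P : Finset α) (hP : n ≤ P.card + c) (hc : 40 * c ≤ n)
    (hb : B.card ≤ 2 * n) (hy : y < 6) :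
    ∃ V0 W S : Finset α, V0 ⊆ P ∧ W ⊆ P \ V0 ∧ S ⊆ (P \ V0) \ W ∧ V0.card < 41 ∧ W.card = y ∧
      S.card ≤ 4 * y ∧ (∀ x ∈ W, ∀ z ∈ W, (x, z) ∉ B) ∧
      (∀ x, deg (ind B (P \ V0)) x < n / 20) ∧
      V0.card * (n / 20) + (ind B (P \ V0)).card ≤ B.card ∧
      ∀ w ∈ W, ∀ x ∈ ((P \ V0) \ W) \ S, (w, x) ∉ B ∧ (x, w) ∉ B := by
  obtain ⟨V0, hV0, h1, h2, -⟩ := greedy B hB (n / 20) (by omega) _ P rfl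
  have hi : (ind B P).card ≤ B.card := card_le_card (ind_sub B P)
  have ht : V0.card < 41 := by
    by_contra h
    have : 41 * (n / 20) ≤ V0.card * (n / 20) := by gcongr; omega
    omega
  set Q := P \ V0 with hQ
  have hQc : P.card ≤ Q.card + V0.card := by
    have := le_card_sdiff V0 P
    rw [← hQ] at this
    omega
  set Low := Q.filter (fun x => deg (ind B Q) x ≤ 4) with hLow
  have hsum : 5 * (Q.filter (fun x => ¬ deg (ind B Q) x ≤ 4)).card ≤ 2 * B.card := by
    have h3 := card_nsmul_le_sum (Q.filter (fun x => ¬ deg (ind B Q) x ≤ 4)) (deg (ind B Q)) 5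
      (fun x hx => by
        have := (mem_filter.1 hx).2
        omega)
    have h4 : ∑ x ∈ Q.filter (fun x => ¬ deg (ind B Q) x ≤ 4), deg (ind B Q) x
        ≤ ∑ x, deg (ind B Q) x := sum_le_sum_of_subset (subset_univ _)
    rw [sum_deg] at h4
    have h5 : (ind B Q).card ≤ B.card := card_le_card (ind_sub B Q)
    rw [smul_eq_mul] at h3
    have h6 := h3.trans h4
    omega
  have hsplit := card_filter_add_card_filter_not (s := Q) (fun x => deg (ind B Q) x ≤ 4)
  rw [← hLow] at hsplit
  have hLc : 25 ≤ Low.card := by omega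
  have hadj : ∀ x ∈ Low, (adj B x ∩ Q).card ≤ 4 := by
    intro x hx
    refine le_trans (card_le_card ?_) ((card_adj_le (ind B Q) x).trans (mem_filter.1 hx).2)
    intro z hz
    rw [mem_inter, mem_adj] at hz
    rw [mem_adj, mem_ind, mem_ind]
    have hxQ := (mem_filter.1 hx).1
    rcases hz.1 with h | h
    · exact Or.inl ⟨h, hxQ, hz.2⟩
    · exact Or.inr ⟨h, hz.2, hxQ⟩
  obtain ⟨W, hW, hWc, hWi⟩ := exists_indep B 4 y Low (by omega) (fun x hx =>
    (card_le_card (inter_subset_inter_left (filter_subset _ _))).trans (hadj x hx))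
  refine ⟨V0, W, (W.biUnion (fun w => adj B w ∩ Q)) \ W, hV0, hW.trans (filter_subset _ _), ?_, ht,
    hWc, ?_, ?_, h2, h1.trans hi, ?_⟩
  · intro x hx
    rw [mem_sdiff] at hx ⊢
    obtain ⟨w, -, h⟩ := mem_biUnion.1 hx.1
    exact ⟨(mem_inter.1 h).2, hx.2⟩
  · refine (card_le_card sdiff_subset).trans ?_
    rw [mul_comm, ← hWc]
    exact card_biUnion_le_card_mul _ _ _ (fun w hw => hadj w (hW hw))
  · intro x hx z hz
    by_cases h : x = z
    · intro h'
      exact hB _ h' h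
    · exact hWi x hx z hz h
  · intro w hw x hx
    rw [mem_sdiff, mem_sdiff] at hx
    have hnot : x ∉ adj B w := by
      intro h
      exact hx.2 (mem_sdiff.2 ⟨mem_biUnion.2 ⟨w, hw, mem_inter.2 ⟨h, hx.1.1⟩⟩, hx.1.2⟩)
    rw [mem_adj, not_or] at hnot
    exact hnot

end core

end partc9

section partc10a
open Finset
set_option linter.unusedSectionVars false

section core
variable {α : Type*} [Fintype α] [DecidableEq α]

theorem tree_notMem {A : Finset (α × α)} (hA : ∀ p ∈ A, p.1 ≠ p.2) {T Y : Finset α} {k : ℕ}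
    (hT : DTree A T) (hY : ∀ y ∈ Y, k ≤ deg A y) (hk : T.card ≤ k) : Disjoint T Y := by
  rw [Finset.disjoint_left]
  intro x hx hxy
  have := hT.deg_le hA hx
  have := hY x hxy
  omega

theorem s_bound (n y j s : ℕ) (hn : 2883 ≤ n) (hy : y < 6) (hj : j ≤ 40 + 4 * y)
    (h : 82 * s + j * (y * (n / 6)) ≤ j * n) : 2 * s ≤ n := by
  have h1 : y * (n / 6) ≤ n := by
    have : y * (n / 6) ≤ 6 * (n / 6) := by gcongr
    omega
  obtain ⟨d, hd⟩ : ∃ d, n = y * (n / 6) + d := ⟨_, (Nat.add_sub_of_le h1).symm⟩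
  have h2 : 82 * s ≤ j * d := by
    have : j * n = j * (y * (n / 6)) + j * d := by rw [← mul_add, ← hd]
    omega
  have h3 : j * d ≤ (40 + 4 * y) * d := by gcongr
  interval_cases y <;> omega

theorem assemble (A B : Finset (α × α))
    (P1 I C J Y W R R' : Finset α) (f1 f3 f5 : α → α) (h1 : PP A B f1 P1) (e1 : P1.image f1 = I)
    (h3 : PP A B f3 C) (e3 : C.image f3 = J) (h5 : PP A B f5 R) (e5 : R.image f5 = R')
    (hP1 : Closed A P1) (hC : Closed A C) (d1 : Disjoint P1 C) (d2 : Disjoint I J)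
    (hYW : Y.card = W.card) (hW : ∀ x ∈ W, ∀ z ∈ W, (x, z) ∉ B)
    (hcr : ∀ w ∈ W, ∀ x ∈ R', (w, x) ∉ B ∧ (x, w) ∉ B)
    (d3 : Disjoint (P1 ∪ C) Y) (d4 : Disjoint (I ∪ J) W)
    (hR : R = univ \ (P1 ∪ C ∪ Y)) (hR' : R' = univ \ (I ∪ J ∪ W)) :
    ∃ τ : Equiv.Perm α, ∀ p ∈ A, (τ p.1, τ p.2) ∉ B := by
  obtain ⟨fa, ha, ea, -, -⟩ := h1.union_closed h3 d1 (by rw [e1, e3]; exact d2) hP1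
  rw [e1, e3] at ea
  have hcl : Closed A (P1 ∪ C) := by
    intro p hp
    rw [mem_union, mem_union, hP1 p hp, hC p hp]
  obtain ⟨f4, i4, m4⟩ := inj_of_card_le Y W hYW.le
  have e4 : Y.image f4 = W := by
    refine eq_of_subset_of_card_le ?_ ?_
    · intro x hx
      obtain ⟨z, hz, rfl⟩ := mem_image.1 hx
      exact m4 z hz
    · rw [card_image_of_injOn i4]; omega
  have h4 : PP A B f4 Y := ⟨i4, fun p _ hp hp' => hW _ (m4 _ hp) _ (m4 _ hp')⟩
  have dYR : Disjoint Y R := by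
    rw [hR, Finset.disjoint_left]
    intro x hx hx'
    simp only [mem_sdiff, mem_union, not_or] at hx'
    exact hx'.2.2 hx
  have dWR : Disjoint W R' := by
    rw [hR', Finset.disjoint_left]
    intro x hx hx'
    simp only [mem_sdiff, mem_union, not_or] at hx'
    exact hx'.2.2 hx
  obtain ⟨fb, hb, eb, -, -⟩ := h4.union h5 dYR (by rw [e4, e5]; exact dWR)
    (fun x hx z hz _ => (hcr _ (m4 x hx) _ (e5 ▸ mem_image_of_mem f5 hz)).1)
    (fun x hx z hz _ => (hcr _ (m4 x hx) _ (e5 ▸ mem_image_of_mem f5 hz)).2)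
  rw [e4, e5] at eb
  obtain ⟨h, hh, -, -, -⟩ := ha.union_closed hb (by
      rw [disjoint_union_right]
      refine ⟨d3, ?_⟩
      rw [hR, Finset.disjoint_left]
      intro x hx hx'
      rw [mem_sdiff, mem_union] at hx'
      exact hx'.2 (Or.inl hx)) (by
      rw [ea, eb, disjoint_union_right]
      refine ⟨d4, ?_⟩
      rw [hR', Finset.disjoint_left]
      intro x hx hx'
      rw [mem_sdiff, mem_union] at hx'
      exact hx'.2 (Or.inl hx)) hcl
  have hall : ∀ x, x ∈ P1 ∪ C ∪ (Y ∪ R) := by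
    intro x
    rw [hR]
    simp only [mem_union, mem_sdiff, mem_univ, true_and]
    tauto
  have hinj : Function.Injective h := fun x z hxz => hh.1 (hall x) (hall z) hxz
  refine ⟨Equiv.ofBijective h (Finite.injective_iff_bijective.1 hinj), ?_⟩
  intro p hp
  exact hh.2 p hp (hall _) (hall _)

end core

end partc10a

section partc10b
open Finset
set_option linter.unusedSectionVars false
section core
variable {α : Type*} [Fintype α] [DecidableEq α]
theorem main_pack (A B : Finset (α × α)) (hA : ∀ p ∈ A, p.1 ≠ p.2) (hB : ∀ p ∈ B, p.1 ≠ p.2)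
    (n m : ℕ) (hn : Fintype.card α = n) (hm : 93 ≤ m) (hmn : 31 * m ≤ n) (ha : A.card = n - m)
    (hb : B.card + n / m + 1 ≤ 2 * n) :
    ∃ τ : Equiv.Perm α, ∀ p ∈ A, (τ p.1, τ p.2) ∉ B := by
  have hn0 : 2883 ≤ n := by omega
  obtain ⟨q, hq⟩ : ∃ q, q = n / m := ⟨_, rfl⟩
  have hq93 : 93 * q ≤ n := by
    have : m * (n / m) ≤ n := Nat.mul_div_le n m
    rw [← hq] at this
    calc 93 * q ≤ m * q := by gcongr
      _ ≤ n := this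
  rw [← hq] at hb
  obtain ⟨T1, T2, 𝒢, hT1, hT2, hT12, hT1q, hT2n, hT1G, hT2G, hGc, hG⟩ :=
    stage_trees A n m q hn hm hmn hq ha
  obtain ⟨f1, hf1, hdeg⟩ := step12 A B hA hB n q hn hn0 hq93 hb hT1 hT1q hT2 hT2n hT12
  have hT12d : Disjoint T1 T2 := closed_disjoint hT1.1 hT2.1 hT12
  obtain ⟨I, hI⟩ : ∃ I, (T1 ∪ T2).image f1 = I := ⟨_, rfl⟩
  rw [hI] at hdeg
  have hIc : I.card = T1.card + T2.card := by
    rw [← hI, card_image_of_injOn hf1.1, card_union_of_disjoint hT12d]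
  -- high degree vertices of A
  obtain ⟨Y, -, hY1, hY2, hY3⟩ := greedy A hA (n / 6) (by omega) _ univ rfl
  rw [ind_univ, ha] at hY1
  have hy : Y.card < 6 := by
    by_contra h
    have : 6 * (n / 6) ≤ Y.card * (n / 6) := by gcongr; omega
    omega
  obtain ⟨P, hP⟩ : ∃ P, P = univ \ I := ⟨_, rfl⟩
  have hPc : P.card = n - I.card := by
    rw [hP, card_sdiff_of_subset (subset_univ _), card_univ, hn]
  obtain ⟨V0, W, S, hV0, hWs, hSs, ht, hWc, hSc, hWi, hQd, hQb, hWcr⟩ :=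
    stage_B B hB n Y.card I.card hn0 P (by omega) (by omega) (by omega) hy
  have hdVS : Disjoint V0 S := by
    rw [Finset.disjoint_left]
    intro x hx hx'
    have := hSs hx'
    simp only [mem_sdiff] at this
    exact this.1.2 hx
  obtain ⟨V, hV⟩ : ∃ V, V = V0 ∪ S := ⟨_, rfl⟩
  have hVc : V.card = V0.card + S.card := by rw [hV, card_union_of_disjoint hdVS]
  obtain ⟨𝒮, h𝒮G, h𝒮c, h𝒮s⟩ := avg_choose (fun T : Finset α => T.card - 1) V.card (𝒢.card - V.card) 𝒢
    (by omega)
  have h𝒮 : ∀ T ∈ 𝒮, DTree A T := fun T hT => (hG T (h𝒮G hT)).1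
  obtain ⟨s, hs⟩ : ∃ s, s = ∑ T ∈ 𝒮, (T.card - 1) := ⟨_, rfl⟩
  rw [← hs] at h𝒮s
  have hdY : ∀ T ∈ 𝒢, Disjoint T Y := fun T hT =>
    tree_notMem hA (hG T hT).1 hY3 (by have := (hG T hT).2; omega)
  have hYu : ∀ F' ⊆ 𝒢, F'.biUnion id ⊆ univ \ Y := by
    intro F' h x hx
    obtain ⟨T, hT, hxT⟩ := mem_biUnion.1 hx
    rw [mem_sdiff]
    exact ⟨mem_univ _, Finset.disjoint_left.1 (hdY T (h hT)) hxT⟩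
  have hs82 : 82 * s + V.card * (Y.card * (n / 6)) ≤ V.card * n := by
    have k1 := tree_arcs A 𝒢 (fun T hT => (hG T hT).1)
    have k2 := sum_pred A 𝒢 (fun T hT => (hG T hT).1)
    have k3 := card_le_card (ind_mono A (hYu 𝒢 Subset.rfl))
    have k4 : ∑ T ∈ 𝒢, (T.card - 1) + Y.card * (n / 6) ≤ n := by omega
    calc 82 * s + V.card * (Y.card * (n / 6))
        ≤ 𝒢.card * s + V.card * (Y.card * (n / 6)) := by gcongr
      _ ≤ V.card * ∑ T ∈ 𝒢, (T.card - 1) + V.card * (Y.card * (n / 6)) := by gcongr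
      _ = V.card * (∑ T ∈ 𝒢, (T.card - 1) + Y.card * (n / 6)) := by ring
      _ ≤ V.card * n := by gcongr
  have hs2 : 2 * s ≤ n := s_bound n Y.card V.card s hn0 hy (by omega) hs82
  -- the target set for the trees
  obtain ⟨G, hGd⟩ : ∃ G, G = ((P \ V0) \ W) \ S := ⟨_, rfl⟩
  have hGcard : G.card + V.card + Y.card = P.card := by
    have k1 := card_sdiff_add_card_eq_card hV0
    have k2 := card_sdiff_add_card_eq_card hWs
    have k3 := card_sdiff_add_card_eq_card hSs
    rw [← hGd] at k3
    omega
  have hVP : V ⊆ P := by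
    rw [hV]
    refine union_subset hV0 (hSs.trans ?_)
    exact sdiff_subset.trans sdiff_subset
  have hGP : G ⊆ P \ V0 := by
    rw [hGd]; exact sdiff_subset.trans sdiff_subset
  have hVG : Disjoint V G := by
    rw [Finset.disjoint_left, hV, hGd]
    intro x hx hx'
    simp only [mem_sdiff, mem_union] at hx hx'
    tauto
  have hWG : Disjoint W G := by
    rw [Finset.disjoint_left, hGd]
    intro x hx hx'
    simp only [mem_sdiff] at hx'
    tauto
  have hWV : Disjoint W V := by
    rw [Finset.disjoint_left, hV]
    intro x hx hx'
    rcases mem_union.1 hx' with h | h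
    · exact (mem_sdiff.1 (hWs hx)).2 h
    · exact (mem_sdiff.1 (hSs h)).2 hx
  obtain ⟨f3, hf3, hf3V, hf3G⟩ := multi A B hA V.card V G 𝒮 rfl h𝒮c h𝒮 hVG (by
    intro X hX
    have hXI : X ∉ I := by
      have := hVP hX
      rw [hP, mem_sdiff] at this
      exact this.2
    have k1 := hdeg X hXI
    have k2 := nonin_card B G X
    have k3 := nonout_card B G X
    unfold deg at k1
    rw [← hs]
    omega) (by
    intro w hw
    have k1 : (adj B w ∩ G).card ≤ deg (ind B (P \ V0)) w := by
      refine le_trans (card_le_card ?_) (card_adj_le _ w)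
      intro z hz
      rw [mem_inter, mem_adj] at hz
      rw [mem_adj, mem_ind, mem_ind]
      have hwQ := hGP hw
      have hzQ := hGP hz.2
      rcases hz.1 with h | h
      · exact Or.inl ⟨h, hwQ, hzQ⟩
      · exact Or.inr ⟨h, hzQ, hwQ⟩
    have k2 := hQd w
    rw [← hs]
    omega)
  obtain ⟨C, hC⟩ : ∃ C, C = 𝒮.biUnion id := ⟨_, rfl⟩
  rw [← hC] at hf3 hf3V hf3G
  obtain ⟨J, hJ⟩ : ∃ J, C.image f3 = J := ⟨_, rfl⟩
  rw [hJ] at hf3V hf3G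
  have hCc : C.card = s + V.card := by rw [hC, sum_pred A 𝒮 h𝒮, h𝒮c, hs]
  have hJc : J.card = C.card := by rw [← hJ, card_image_of_injOn hf3.1]
  have hCcl : Closed A C := by rw [hC]; exact closed_biUnion 𝒮 (fun T hT => (h𝒮 T hT).1.1)
  have hP1cl : Closed A (T1 ∪ T2) := by
    intro p hp
    rw [mem_union, mem_union, hT1.1.1 p hp, hT2.1.1 p hp]
  have d1 : Disjoint (T1 ∪ T2) C := by
    rw [hC, disjoint_biUnion_right]
    intro T hT
    rw [disjoint_union_left]
    exact ⟨closed_disjoint hT1.1 (h𝒮 T hT).1 (fun h => hT1G (h ▸ h𝒮G hT)),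
      closed_disjoint hT2.1 (h𝒮 T hT).1 (fun h => hT2G (h ▸ h𝒮G hT))⟩
  have hJP : J ⊆ P := hf3G.trans (union_subset hVP (hGP.trans sdiff_subset))
  have hdIP : Disjoint I P := by rw [hP]; exact disjoint_sdiff
  have d2 : Disjoint I J := hdIP.mono_right hJP
  have d3 : Disjoint (T1 ∪ T2 ∪ C) Y := by
    rw [disjoint_union_left, disjoint_union_left]
    refine ⟨⟨tree_notMem hA hT1 hY3 (by omega), tree_notMem hA hT2 hY3 (by omega)⟩, ?_⟩
    rw [hC, disjoint_biUnion_left]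
    exact fun T hT => hdY T (h𝒮G hT)
  have hWP : W ⊆ P := hWs.trans sdiff_subset
  have d4 : Disjoint (I ∪ J) W := by
    rw [disjoint_union_left]
    refine ⟨hdIP.mono_right hWP, ?_⟩
    exact Disjoint.mono_left hf3G (by
      rw [disjoint_union_left]; exact ⟨hWV.symm, hWG.symm⟩)
  obtain ⟨R, hR⟩ : ∃ R, R = univ \ (T1 ∪ T2 ∪ C ∪ Y) := ⟨_, rfl⟩
  obtain ⟨R', hR'⟩ : ∃ R', R' = univ \ (I ∪ J ∪ W) := ⟨_, rfl⟩
  have hRc : R.card + (T1.card + T2.card + C.card + Y.card) = n := by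
    have := card_sdiff_add_card_eq_card (subset_univ (T1 ∪ T2 ∪ C ∪ Y))
    rw [← hR, card_union_of_disjoint d3, card_union_of_disjoint d1, card_union_of_disjoint hT12d,
      card_univ, hn] at this
    exact this
  have hRc' : R'.card + (I.card + J.card + W.card) = n := by
    have := card_sdiff_add_card_eq_card (subset_univ (I ∪ J ∪ W))
    rw [← hR', card_union_of_disjoint d4, card_union_of_disjoint d2, card_univ, hn] at this
    exact this
  have hR'G : R' ⊆ G := by
    intro x hx
    rw [hR'] at hx
    simp only [mem_sdiff, mem_union, not_or, mem_univ, true_and] at hx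
    have hxV : x ∉ V := fun h => hx.1.2 (hf3V h)
    rw [hV, mem_union, not_or] at hxV
    rw [hGd, hP]
    simp only [mem_sdiff, mem_univ, true_and]
    exact ⟨⟨⟨hx.1.1, hxV.1⟩, hx.2⟩, hxV.2⟩
  have hRY : R ⊆ univ \ Y := by
    rw [hR]; exact sdiff_subset_sdiff Subset.rfl subset_union_right
  have haR : (ind A R).card + Y.card * (n / 6) + 26 ≤ R.card := by
    have hsub : T1 ∪ T2 ∪ C ⊆ univ \ Y := by
      intro x hx
      exact mem_sdiff.2 ⟨mem_univ _, Finset.disjoint_left.1 d3 hx⟩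
    have hRd : Disjoint R (T1 ∪ T2 ∪ C) := by
      rw [hR, Finset.disjoint_left]
      intro x hx hx'
      rw [mem_sdiff, mem_union] at hx
      exact hx.2 (Or.inl hx')
    have k1 := ind_disj_add A hRd hRY hsub
    have k2 := ind_disj_add A d1 (subset_union_left) (subset_union_right)
    have k3 := ind_disj_add A hT12d (subset_union_left) (subset_union_right)
    have k4 := tree_arcs A 𝒮 h𝒮
    rw [← hC] at k4
    have k5 := hT1.2
    have k6 := hT2.2
    omega
  have hbR : (ind B R').card + V0.card * (n / 20) ≤ 2 * n := by
    have := card_le_card (ind_mono B (hR'G.trans hGP))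
    omega
  obtain ⟨n1, n2, n3⟩ := numerics n V0.card Y.card V.card s T1.card T2.card R.card (ind A R).card
    (ind B R').card hn0 ht hy (by omega) (by omega) (by omega) hT2n hs82 haR hbR
  have hRR : R'.card = R.card := by
    clear * - hRc hRc' hIc hJc hWc
    omega
  have hcg : 2 * ((ind A R).card + (ind B R').card) < n / 8 * 49 := by
    clear * - hRc haR hbR hn0
    omega
  have g1 : ∀ x, deg (ind A R) x ≤ n / 6 := fun x =>
    (deg_mono (ind_mono A hRY) x).trans (hY2 x).le
  have g2 : ∀ x, deg (ind B R') x ≤ n / 20 := fun x =>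
    (deg_mono (ind_mono B (hR'G.trans hGP)) x).trans (hQd x).le
  generalize R.card - n / 6 - n / 20 - n / 8 - 350 = T0 at n2 n3
  obtain ⟨f5, hf5, e5⟩ := core_on A B hA hB R R' R.card (ind A R).card (ind B R').card rfl
    hRR rfl rfl (n / 6) (n / 20) 7 T0 (n / 8) 49 g1 g2 n1 n3 hcg n2
  exact assemble A B (T1 ∪ T2) I C J Y W R R' f1 f3 f5 hf1 hI hf3 hJ hf5 e5 hP1cl hCcl d1 d2
    hWc.symm hWi (fun w hw x hx => hWcr w hw x (hGd ▸ hR'G hx)) d3 d4 hR hR'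

end core

end partc10b

section final
open Finset

theorem card_fin_filter (n : ℕ) (P : ℕ → Prop) [DecidablePred P] :
    (univ.filter (fun x : Fin n => P x.val)).card = ((range n).filter P).card := by
  rw [← card_map Fin.valEmbedding]
  congr 1
  ext x
  simp only [mem_map, mem_filter, mem_univ, true_and, Fin.valEmbedding_apply, mem_range]
  constructor
  · rintro ⟨a, h, rfl⟩
    exact ⟨a.2, h⟩
  · rintro ⟨h, h'⟩
    exact ⟨⟨x, h⟩, h', rfl⟩

theorem example_bound (m n : ℕ) (hm : 93 ≤ m) (hn : 31 * m ≤ n) :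
    ∃ A A' : Finset (Fin n × Fin n),
        IsDigraph A ∧ IsDigraph A' ∧ A.card = n - m ∧ A'.card = 2 * n - n / m ∧ ¬ Packs A A' := by
  obtain ⟨q, hq⟩ : ∃ q, q = n / m := ⟨_, rfl⟩
  have hq1 : q * m ≤ n := hq ▸ Nat.div_mul_le_self n m
  have hq2 : 31 ≤ q := by rw [hq]; exact (Nat.le_div_iff_mul_le (by omega)).2 hn
  have hq3 : q ≤ n := by rw [hq]; exact Nat.div_le_self _ _
  have hn0 : 0 < n := by omega
  rw [← hq]
  obtain ⟨z, hz⟩ : ∃ z : Fin n, z.val = 0 := ⟨⟨0, hn0⟩, rfl⟩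
  let c : Fin n → Fin n := fun x => ⟨x.val % m, lt_of_lt_of_le (Nat.mod_lt _ (by omega)) (by omega)⟩
  refine ⟨(univ.filter (fun x : Fin n => m ≤ x.val)).image (fun x => (c x, x)),
    (univ.filter (fun x : Fin n => 1 ≤ x.val)).image (fun x => (x, z)) ∪
    (univ.filter (fun x : Fin n => 1 ≤ x.val ∧ x.val ≤ n + 1 - q)).image (fun x => (z, x)),
    ?_, ?_, ?_, ?_, ?_⟩
  · intro p hp
    obtain ⟨x, hx, rfl⟩ := mem_image.1 hp
    have h1 := (mem_filter.1 hx).2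
    have h2 : x.val % m < m := Nat.mod_lt _ (by omega)
    intro h
    have : x.val % m = x.val := congrArg Fin.val h
    omega
  · intro p hp h
    rcases mem_union.1 hp with hp | hp
    · obtain ⟨x, hx, rfl⟩ := mem_image.1 hp
      have h1 := (mem_filter.1 hx).2
      have h2 : x.val = z.val := congrArg Fin.val h
      omega
    · obtain ⟨x, hx, rfl⟩ := mem_image.1 hp
      have h1 := (mem_filter.1 hx).2
      have h2 : z.val = x.val := congrArg Fin.val h
      omega
  · rw [card_image_of_injective _ (fun x y h => (Prod.ext_iff.1 h).2),
      card_fin_filter n (fun x => m ≤ x)]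
    have : (range n).filter (fun x => m ≤ x) = Ico m n := by
      ext x; simp only [mem_filter, mem_range, mem_Ico]; omega
    rw [this, Nat.card_Ico]
  · rw [card_union_of_disjoint, card_image_of_injective _ (fun x y h => (Prod.ext_iff.1 h).1),
      card_image_of_injective _ (fun x y h => (Prod.ext_iff.1 h).2),
      card_fin_filter n (fun x => 1 ≤ x), card_fin_filter n (fun x => 1 ≤ x ∧ x ≤ n + 1 - q)]
    · have h1 : (range n).filter (fun x => 1 ≤ x) = Ico 1 n := by
        ext x; simp only [mem_filter, mem_range, mem_Ico]; omega
      have h2 : (range n).filter (fun x => 1 ≤ x ∧ x ≤ n + 1 - q) = Ico 1 (n + 2 - q) := by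
        ext x; simp only [mem_filter, mem_range, mem_Ico]; omega
      rw [h1, h2, Nat.card_Ico, Nat.card_Ico]
      omega
    · rw [Finset.disjoint_left]
      intro p hp hp'
      obtain ⟨x, hx, rfl⟩ := mem_image.1 hp
      obtain ⟨y, hy, h⟩ := mem_image.1 hp'
      have h1 := (mem_filter.1 hx).2
      have h2 : z.val = x.val := congrArg Fin.val (Prod.ext_iff.1 h).1
      omega
  · rintro ⟨f, hf⟩
    obtain ⟨u, hu⟩ : ∃ u, f u = z := ⟨f.symm z, by simp⟩
    have hne : ∀ x, x ≠ u → 1 ≤ (f x).val := by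
      intro x hx
      by_contra h
      apply hx
      apply f.injective
      rw [hu]
      apply Fin.ext
      omega
    have hum : u.val < m := by
      by_contra h
      have hA : (c u, u) ∈ (univ.filter (fun x : Fin n => m ≤ x.val)).image (fun x => (c x, x)) :=
        mem_image.2 ⟨u, mem_filter.2 ⟨mem_univ _, by omega⟩, rfl⟩
      refine hf _ hA (mem_union_left _ (mem_image.2 ⟨f (c u), mem_filter.2 ⟨mem_univ _, ?_⟩, ?_⟩))
      · apply hne
        intro h'
        have h1 : u.val % m = u.val := congrArg Fin.val h'
        have h2 : u.val % m < m := Nat.mod_lt _ (by omega)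
        omega
      · simp only [hu]
    have hlt : ∀ i < q, u.val + i * m < n := by
      intro i hi
      have : (i + 1) * m ≤ q * m := by gcongr; omega
      rw [add_mul] at this
      omega
    have key : ∀ i, 1 ≤ i → ∀ hi : i < q, n + 2 - q ≤ (f ⟨u.val + i * m, hlt i hi⟩).val := by
      intro i h1 hi
      have hmi : m ≤ i * m := Nat.le_mul_of_pos_left m h1
      set x : Fin n := ⟨u.val + i * m, hlt i hi⟩ with hx
      have hcx : c x = u := by
        apply Fin.ext
        show (u.val + i * m) % m = u.val
        rw [Nat.add_mul_mod_self_right, Nat.mod_eq_of_lt hum]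
      have hA : (c x, x) ∈ (univ.filter (fun x : Fin n => m ≤ x.val)).image (fun x => (c x, x)) :=
        mem_image.2 ⟨x, mem_filter.2 ⟨mem_univ _, by show m ≤ u.val + i * m; omega⟩, rfl⟩
      have h2 : 1 ≤ (f x).val := by
        apply hne
        intro h
        have : u.val + i * m = u.val := congrArg Fin.val h
        omega
      by_contra hlt'
      refine hf _ hA (mem_union_right _ (mem_image.2 ⟨f x, mem_filter.2 ⟨mem_univ _, h2, by omega⟩, ?_⟩))
      simp only [hcx, hu]
    have hcard : (Ico 1 q).card ≤ (Ico (n + 2 - q) n).card := by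
      refine card_le_card_of_injOn
        (fun i => if hi : i < q then (f ⟨u.val + i * m, hlt i hi⟩).val else 0) ?_ ?_
      · intro i hi
        have hi' := mem_Ico.1 (mem_coe.1 hi)
        simp only [hi'.2, dif_pos, coe_Ico, Set.mem_Ico]
        exact ⟨key i hi'.1 hi'.2, Fin.is_lt _⟩
      · intro i hi j hj h
        have hi' := mem_Ico.1 (mem_coe.1 hi)
        have hj' := mem_Ico.1 (mem_coe.1 hj)
        simp only [hi'.2, hj'.2, dif_pos] at h
        have h1 := congrArg Fin.val (f.injective (Fin.ext h))
        simp only [add_right_inj] at h1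
        exact Nat.eq_of_mul_eq_mul_right (by omega) h1
    rw [Nat.card_Ico, Nat.card_Ico] at hcard
    omega

end final

/-- For `m ≥ 93` and `n ≥ 31 m`, `μ(n, n - m) = 2n - ⌊n/m⌋`: the smallest `N`
for which there are digraphs on `n` vertices with `n - m` arcs and `N` arcs,
respectively, that do not pack, equals `2n - ⌊n/m⌋`. -/
theorem wojda_conjecture (m n : ℕ) (hm : 93 ≤ m) (hn : 31 * m ≤ n) :
    sInf {N : ℕ | ∃ A A' : Finset (Fin n × Fin n),
        IsDigraph A ∧ IsDigraph A' ∧ A.card = n - m ∧ A'.card = N ∧ ¬ Packs A A'}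
      = 2 * n - n / m := by
  refine le_antisymm (Nat.sInf_le (example_bound m n hm hn)) ?_
  refine le_csInf ⟨_, example_bound m n hm hn⟩ ?_
  rintro N ⟨A, A', hA, hA', hc, hc', hp⟩
  by_contra hlt
  apply hp
  exact main_pack A A' hA hA' n m (Fintype.card_fin n) hm hn hc (by omega)
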